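/- There exists a universal constant c > 0 with the following property. Consider T ≥ 3 rounds of a corrupted n-player general-sum game (player i has m_i actions, utilities in [−1,1], m = max_i m_i) in which every player runs Algorithm 1 producing x̂_i^(t) ∈ Δ_{m_i}, plays x_i^(t) with Σ_{t=1}^T ‖x_i^(t) − x̂_i^(t)‖_1 ≤ Ĉ_i, and observes ũ_i^(t) with ‖ũ_i^(t)‖_∞ ≤ 1 and Σ_{t=1}^T ‖u_i^(t) − ũ_i^(t)‖_∞ ≤ C̃_i, where u_i^(t) is the expected utility vector induced by the actual plays. Set Ŝ = Σ_{i=1}^n Ĉ_i, S̃ = Σ_{i=1}^n C̃_i, C_i = 2Ĉ_i + 2C̃_i. Then every player i's swap regret SwapReg_{x_i,u_i} = max_{M∈M_{m_i}} Σ_{t=1}^T ⟨x_i^(t), M u_i^(t) − u_i^(t)⟩ satisfies SwapReg_{x_i,u_i} ≤ c ( n m^{5/2} log T + min{ m √( ( Ŝ(n + √m) + S̃ √m ) log T ), m_i √(T log T) } + C_i ). -/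

import Mathlib

open Finset

noncomputable section

/-- The `(d-1)`-dimensional probability simplex in `ℝ^d`. -/
def simplex (d : ℕ) : Set (Fin d → ℝ) :=
  {x | (∀ k, 0 ≤ x k) ∧ ∑ k, x k = 1}

/-- Standard inner product on `ℝ^d`. -/
def inp {d : ℕ} (u v : Fin d → ℝ) : ℝ := ∑ k, u k * v k

/-- `ℓ¹` norm. -/
def l1 {d : ℕ} (v : Fin d → ℝ) : ℝ := ∑ k, |v k|

/-- `ℓ∞` norm. -/
def linf {d : ℕ} (v : Fin d → ℝ) : ℝ := ⨆ k, |v k|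

/-- Matrix-vector product `A y`. -/
def mvec {d e : ℕ} (A : Fin d → Fin e → ℝ) (v : Fin e → ℝ) : Fin d → ℝ :=
  fun i => ∑ j, A i j * v j

/-- Transposed matrix-vector product `Aᵀ x`. -/
def tvec {d e : ℕ} (A : Fin d → Fin e → ℝ) (v : Fin d → ℝ) : Fin e → ℝ :=
  fun j => ∑ i, A i j * v i

/-- Row-stochastic matrices. -/
def rowStoch {m : ℕ} (M : Fin m → Fin m → ℝ) : Prop :=
  ∀ a, M a ∈ simplex m

/-- Shannon entropy. -/
def shannonH {d : ℕ} (x : Fin d → ℝ) : ℝ := ∑ k, x k * Real.log (1 / x k)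

/-- Log-barrier regularizer. -/
def logBarrier {d : ℕ} (x : Fin d → ℝ) : ℝ := -∑ k, Real.log (x k)

/-- Local norm `‖h‖_{x,φ}` induced by the Hessian of the log-barrier at `x`. -/
def locNorm {d : ℕ} (x h : Fin d → ℝ) : ℝ := Real.sqrt (∑ k, (h k) ^ 2 / (x k) ^ 2)

/-- Dual local norm `‖h‖_{*,x,φ}` for the log-barrier at `x`. -/
def dualLocNorm {d : ℕ} (x h : Fin d → ℝ) : ℝ := Real.sqrt (∑ k, (x k) ^ 2 * (h k) ^ 2)

/-- `log₊ z = max (log z) 4`. -/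
def logp (z : ℕ) : ℝ := max (Real.log z) 4


/-! ### Basic facts about the norms and the simplex -/

lemma abs_le_linf {d : ℕ} (v : Fin d → ℝ) (k : Fin d) : |v k| ≤ linf v :=
  le_ciSup (f := fun k => |v k|) (Set.finite_range _).bddAbove k

lemma linf_le {d : ℕ} {v : Fin d → ℝ} {B : ℝ} (hB : 0 ≤ B) (h : ∀ k, |v k| ≤ B) :
    linf v ≤ B :=
  Real.iSup_le h hB

lemma linf_nonneg {d : ℕ} (v : Fin d → ℝ) : 0 ≤ linf v :=
  Real.iSup_nonneg fun _ => abs_nonneg _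

lemma linf_zero {d : ℕ} : linf (0 : Fin d → ℝ) = 0 :=
  le_antisymm (linf_le le_rfl fun k => by simp) (linf_nonneg _)

lemma linf_add_le {d : ℕ} (v w : Fin d → ℝ) : linf (v + w) ≤ linf v + linf w :=
  linf_le (add_nonneg (linf_nonneg v) (linf_nonneg w)) fun k =>
    (abs_add_le _ _).trans (add_le_add (abs_le_linf v k) (abs_le_linf w k))

lemma linf_neg {d : ℕ} (v : Fin d → ℝ) : linf (-v) = linf v := by
  simp [linf]

lemma linf_sub_le {d : ℕ} (v w : Fin d → ℝ) : linf (v - w) ≤ linf v + linf w := by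
  simpa [sub_eq_add_neg, linf_neg] using linf_add_le v (-w)

lemma linf_smul {d : ℕ} (r : ℝ) (v : Fin d → ℝ) : linf (r • v) = |r| * linf v := by
  simp only [linf, Pi.smul_apply, smul_eq_mul, abs_mul]
  exact (Real.mul_iSup_of_nonneg (abs_nonneg r) _).symm

lemma l1_nonneg {d : ℕ} (v : Fin d → ℝ) : 0 ≤ l1 v :=
  Finset.sum_nonneg fun _ _ => abs_nonneg _

lemma l1_add_le {d : ℕ} (v w : Fin d → ℝ) : l1 (v + w) ≤ l1 v + l1 w := by
  simp only [l1, ← Finset.sum_add_distrib]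
  exact Finset.sum_le_sum fun k _ => abs_add_le _ _

lemma l1_neg {d : ℕ} (v : Fin d → ℝ) : l1 (-v) = l1 v := by
  simp [l1]

lemma l1_sub_comm {d : ℕ} (v w : Fin d → ℝ) : l1 (v - w) = l1 (w - v) := by
  rw [← l1_neg, neg_sub]

lemma l1_sub_le {d : ℕ} (v w z : Fin d → ℝ) : l1 (v - z) ≤ l1 (v - w) + l1 (w - z) := by
  simpa using l1_add_le (v - w) (w - z)

lemma l1_simplex {d : ℕ} {x : Fin d → ℝ} (hx : x ∈ simplex d) : l1 x = 1 := by
  rw [← hx.2]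
  exact Finset.sum_congr rfl fun k _ => abs_of_nonneg (hx.1 k)

lemma l1_sub_le_two {d : ℕ} {x y : Fin d → ℝ} (hx : x ∈ simplex d) (hy : y ∈ simplex d) :
    l1 (x - y) ≤ 2 := by
  have h := l1_add_le x (-y)
  rw [l1_neg, l1_simplex hx, l1_simplex hy, ← sub_eq_add_neg] at h
  linarith

lemma simplex_le_one {d : ℕ} {x : Fin d → ℝ} (hx : x ∈ simplex d) (k : Fin d) : x k ≤ 1 := by
  rw [← hx.2]
  exact Finset.single_le_sum (fun k _ => hx.1 k) (Finset.mem_univ k)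

lemma sum_sq_simplex_le_one {d : ℕ} {x : Fin d → ℝ} (hx : x ∈ simplex d) :
    ∑ k, x k ^ 2 ≤ 1 := by
  rw [← hx.2]
  exact Finset.sum_le_sum fun k _ => by nlinarith [hx.1 k, simplex_le_one hx k]

lemma sum_sq_le_l1_sq {d : ℕ} (v : Fin d → ℝ) : ∑ k, v k ^ 2 ≤ l1 v ^ 2 := by
  simp only [← sq_abs (v _)]
  exact Finset.sum_sq_le_sq_sum_of_nonneg fun k _ => abs_nonneg _

lemma abs_inp_le {d : ℕ} (v w : Fin d → ℝ) : |inp v w| ≤ l1 v * linf w := by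
  simp only [inp, l1, Finset.sum_mul]
  refine (Finset.abs_sum_le_sum_abs _ _).trans (Finset.sum_le_sum fun k _ => ?_)
  rw [abs_mul]
  exact mul_le_mul_of_nonneg_left (abs_le_linf w k) (abs_nonneg _)

lemma inp_add_right {d : ℕ} (v w z : Fin d → ℝ) : inp v (w + z) = inp v w + inp v z := by
  simp [inp, mul_add, Finset.sum_add_distrib]

lemma inp_sub_right {d : ℕ} (v w z : Fin d → ℝ) : inp v (w - z) = inp v w - inp v z := by
  simp [inp, mul_sub, Finset.sum_sub_distrib]

lemma inp_sub_left {d : ℕ} (v w z : Fin d → ℝ) : inp (v - w) z = inp v z - inp w z := by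
  simp [inp, sub_mul, Finset.sum_sub_distrib]

lemma inp_smul_right {d : ℕ} (r : ℝ) (v w : Fin d → ℝ) : inp v (r • w) = r * inp v w := by
  simp only [inp, Pi.smul_apply, smul_eq_mul, Finset.mul_sum]
  exact Finset.sum_congr rfl fun k _ => by ring

lemma inp_sum_right {d : ℕ} {ι : Type*} (s : Finset ι) (v : Fin d → ℝ) (w : ι → Fin d → ℝ) :
    inp v (∑ t ∈ s, w t) = ∑ t ∈ s, inp v (w t) := by
  simp only [inp, Finset.sum_apply, Finset.mul_sum]
  exact Finset.sum_comm

lemma linf_mvec_le {d : ℕ} {M : Fin d → Fin d → ℝ} (hM : rowStoch M) (v : Fin d → ℝ) :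
    linf (mvec M v) ≤ linf v := by
  refine linf_le (linf_nonneg v) fun k => ?_
  have h := abs_inp_le (M k) v
  rwa [l1_simplex (hM k), one_mul] at h

lemma mvec_sub {d e : ℕ} (A : Fin d → Fin e → ℝ) (v w : Fin e → ℝ) :
    mvec A (v - w) = mvec A v - mvec A w :=
  funext fun k => inp_sub_right (A k) v w

/-! ### Perturbation of stationary distributions -/

/-- A row-stochastic matrix has a stationary distribution. -/
lemma exists_stationary {d : ℕ} [NeZero d] {Q : Fin d → Fin d → ℝ} (hQ : rowStoch Q) :
    ∃ p ∈ simplex d, ∀ b, ∑ a, Q a b * p a = p b := by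
  have hdet : (Matrix.of Q - 1).det = 0 := by
    refine Matrix.exists_mulVec_eq_zero_iff.mp ⟨fun _ => 1, ?_, ?_⟩
    · intro h
      simpa using congrFun h 0
    · ext a
      have h := (hQ a).2
      simp only [Matrix.sub_mulVec, Matrix.one_mulVec, Pi.sub_apply, Pi.zero_apply]
      simp [Matrix.mulVec, dotProduct, h]
  obtain ⟨v, hv0, hv⟩ := Matrix.exists_vecMul_eq_zero_iff.mpr hdet
  have hst : ∀ b, ∑ a, Q a b * v a = v b := by
    intro b
    have h := congrFun hv b
    simp only [Matrix.vecMul_sub, Matrix.vecMul_one, Pi.sub_apply, Pi.zero_apply] at h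
    simp only [Matrix.vecMul, dotProduct, Matrix.of_apply] at h
    rw [← sub_eq_zero, ← h]
    simp [mul_comm]
  have hle : ∀ b ∈ (Finset.univ : Finset (Fin d)), |v b| ≤ ∑ a, Q a b * |v a| := by
    intro b _
    rw [← hst b]
    refine (Finset.abs_sum_le_sum_abs _ _).trans (Finset.sum_le_sum fun a _ => ?_)
    rw [abs_mul, abs_of_nonneg ((hQ a).1 b)]
  have hsum : ∑ b, |v b| = ∑ b, ∑ a, Q a b * |v a| := by
    rw [Finset.sum_comm]
    refine Finset.sum_congr rfl fun a _ => ?_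
    rw [← Finset.sum_mul, (hQ a).2, one_mul]
  have heq := (Finset.sum_eq_sum_iff_of_le hle).mp hsum
  have hpos : 0 < ∑ b, |v b| := by
    obtain ⟨k, hk⟩ := Function.ne_iff.mp hv0
    exact Finset.sum_pos' (fun b _ => abs_nonneg _) ⟨k, Finset.mem_univ k, abs_pos.mpr hk⟩
  refine ⟨fun b => |v b| / ∑ b, |v b|, ⟨fun k => by positivity, ?_⟩, fun b => ?_⟩
  · rw [← Finset.sum_div, div_self hpos.ne']
  · simp only [← mul_div_assoc, ← Finset.sum_div]
    rw [← heq b (Finset.mem_univ b)]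

lemma stationary_pos {d : ℕ} {Q : Fin d → Fin d → ℝ} (hQp : ∀ a b, 0 < Q a b)
    {p : Fin d → ℝ} (hp : p ∈ simplex d) (hst : ∀ b, ∑ a, Q a b * p a = p b) (b : Fin d) :
    0 < p b := by
  have hex : ∃ c, 0 < p c := by
    by_contra! h
    have h1 := hp.2
    have h2 : ∑ k, p k ≤ 0 := Finset.sum_nonpos fun k _ => h k
    linarith
  obtain ⟨c, hc⟩ := hex
  rw [← hst b]
  exact Finset.sum_pos' (fun a _ => mul_nonneg (hQp a b).le (hp.1 a))
    ⟨c, Finset.mem_univ c, mul_pos (hQp c b) hc⟩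

/-- Minimum principle for the chain killed at the state `a`. -/
lemma nonneg_of_killed_superharmonic {d : ℕ} {Q : Fin d → Fin d → ℝ} (hQ : rowStoch Q)
    (hQp : ∀ a b, 0 < Q a b) (a : Fin d) (w : Fin d → ℝ)
    (hw : ∀ b ≠ a, ∑ c ∈ Finset.univ.erase a, Q c b * w c ≤ w b) :
    ∀ b ≠ a, 0 ≤ w b := by
  have hneg : ∀ b ∈ Finset.univ.erase a,
      max (-w b) 0 ≤ ∑ c ∈ Finset.univ.erase a, Q c b * max (-w c) 0 := by
    intro b hb
    refine max_le ?_ (Finset.sum_nonneg fun c _ => mul_nonneg (hQp c b).le (le_max_right _ _))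
    have h1 := hw b (Finset.ne_of_mem_erase hb)
    have h2 : ∑ c ∈ Finset.univ.erase a, Q c b * (-w c)
        ≤ ∑ c ∈ Finset.univ.erase a, Q c b * max (-w c) 0 :=
      Finset.sum_le_sum fun c _ => mul_le_mul_of_nonneg_left (le_max_left _ _) (hQp c b).le
    simp only [mul_neg, Finset.sum_neg_distrib] at h2
    linarith
  have hrow : ∀ c, ∑ b ∈ Finset.univ.erase a, Q c b = 1 - Q c a := by
    intro c
    rw [← (hQ c).2, ← Finset.add_sum_erase _ _ (Finset.mem_univ a)]
    ring
  have hsum := Finset.sum_le_sum hneg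
  rw [Finset.sum_comm] at hsum
  simp only [← Finset.sum_mul, hrow, sub_mul, one_mul, Finset.sum_sub_distrib] at hsum
  intro b hb
  by_contra! h
  have hpos : 0 < ∑ c ∈ Finset.univ.erase a, Q c a * max (-w c) 0 :=
    Finset.sum_pos' (fun c _ => mul_nonneg (hQp c a).le (le_max_right _ _))
      ⟨b, Finset.mem_erase.mpr ⟨hb, Finset.mem_univ b⟩,
        mul_pos (hQp b a) (lt_max_of_lt_left (by linarith))⟩
  linarith

/-- Changing a single row multiplicatively changes the stationary distribution by a
proportional amount. -/
lemma stationary_perturb_row {d : ℕ} {Q R : Fin d → Fin d → ℝ}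
    (hQ : rowStoch Q) (hQp : ∀ a b, 0 < Q a b) (hRp : ∀ a b, 0 < R a b)
    (a : Fin d) (hoff : ∀ c ≠ a, R c = Q c) {μ : ℝ} (hμ0 : 0 ≤ μ)
    (hμ : μ < 1 / 2 → ∀ b, |R a b - Q a b| ≤ μ * Q a b)
    {p q : Fin d → ℝ} (hp : p ∈ simplex d) (hq : q ∈ simplex d)
    (hpst : ∀ b, ∑ a, Q a b * p a = p b) (hqst : ∀ b, ∑ a, R a b * q a = q b) :
    l1 (p - q) ≤ 8 * μ := by
  rcases le_or_gt (1 / 2) μ with hbig | hsmall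
  · linarith [l1_sub_le_two hp hq]
  replace hμ := hμ hsmall
  have hpa := stationary_pos hQp hp hpst a
  have hqa := stationary_pos hRp hq hqst a
  have hps : ∀ b, p b = Q a b * p a + ∑ c ∈ Finset.univ.erase a, Q c b * p c := fun b => by
    rw [Finset.add_sum_erase _ (fun c => Q c b * p c) (Finset.mem_univ a), hpst]
  have hqs : ∀ b, q b = R a b * q a + ∑ c ∈ Finset.univ.erase a, Q c b * q c := fun b => by
    rw [← hqst b, ← Finset.add_sum_erase _ (fun c => R c b * q c) (Finset.mem_univ a)]
    congr 1
    exact Finset.sum_congr rfl fun c hc => by rw [hoff c (Finset.ne_of_mem_erase hc)]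
  have hcomb : ∀ (α β : ℝ) (b : Fin d),
      ∑ c ∈ Finset.univ.erase a, Q c b * (α * q c - β * p c)
        = α * (q b - R a b * q a) - β * (p b - Q a b * p a) := by
    intro α β b
    have h1 := hps b
    have h2 := hqs b
    have h3 : ∑ c ∈ Finset.univ.erase a, Q c b * (α * q c - β * p c)
        = α * ∑ c ∈ Finset.univ.erase a, Q c b * q c
          - β * ∑ c ∈ Finset.univ.erase a, Q c b * p c := by
      rw [Finset.mul_sum, Finset.mul_sum, ← Finset.sum_sub_distrib]
      exact Finset.sum_congr rfl fun c _ => by ring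
    rw [h3]
    linear_combination α * (-h2) - β * (-h1)
  have hlo : ∀ b ≠ a, 0 ≤ p a * q b - (1 - μ) * q a * p b := by
    refine nonneg_of_killed_superharmonic hQ hQp a _ fun b _ => ?_
    rw [hcomb]
    have h := (abs_le.mp (hμ b)).1
    have h2 : 0 ≤ p a * q a * (R a b - Q a b + μ * Q a b) := by
      have : 0 ≤ R a b - Q a b + μ * Q a b := by linarith
      positivity
    nlinarith
  have hhi : ∀ b ≠ a, 0 ≤ -p a * q b - (-(1 + μ) * q a) * p b := by
    refine nonneg_of_killed_superharmonic hQ hQp a _ fun b _ => ?_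
    rw [hcomb]
    have h := (abs_le.mp (hμ b)).2
    have h2 : 0 ≤ p a * q a * (μ * Q a b - (R a b - Q a b)) := by
      have : 0 ≤ μ * Q a b - (R a b - Q a b) := by linarith
      positivity
    nlinarith
  have hpe : ∑ c ∈ Finset.univ.erase a, p c = 1 - p a := by
    rw [← hp.2, ← Finset.add_sum_erase _ _ (Finset.mem_univ a)]
    ring
  have hqe : ∑ c ∈ Finset.univ.erase a, q c = 1 - q a := by
    rw [← hq.2, ← Finset.add_sum_erase _ _ (Finset.mem_univ a)]
    ring
  have hqpa : (1 - μ) * q a ≤ p a := by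
    have h : 0 ≤ ∑ c ∈ Finset.univ.erase a, (p a * q c - (1 - μ) * q a * p c) :=
      Finset.sum_nonneg fun c hc => hlo c (Finset.ne_of_mem_erase hc)
    rw [Finset.sum_sub_distrib, ← Finset.mul_sum, ← Finset.mul_sum, hpe, hqe] at h
    nlinarith [mul_nonneg hμ0 (mul_pos hqa hpa).le]
  have hratio : ∀ b, (1 - μ) * q b ≤ (1 + μ) * p b := by
    intro b
    by_cases hb : b = a
    · subst hb
      nlinarith
    · have h1 := hhi b hb
      have h2 : (1 + μ) * p b * ((1 - μ) * q a) ≤ (1 + μ) * p b * p a :=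
        mul_le_mul_of_nonneg_left hqpa (mul_nonneg (by linarith) (hp.1 b))
      have h3 : p a * ((1 - μ) * q b) ≤ p a * ((1 + μ) * p b) := by
        nlinarith [mul_nonneg (show 0 ≤ 1 - μ by linarith) h1]
      exact le_of_mul_le_mul_left h3 hpa
  have hpt : ∀ b, |p b - q b| ≤ 2 * (4 * μ * p b) + (p b - q b) := by
    intro b
    have h0 := hp.1 b
    have h1 := hratio b
    have h2 : q b ≤ p b + 4 * μ * p b := by
      have h3 : 0 ≤ μ * p b * (1 - 2 * μ) :=
        mul_nonneg (mul_nonneg hμ0 h0) (by linarith)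
      have h4 : (1 - μ) * q b ≤ (1 - μ) * (p b + 4 * μ * p b) := by nlinarith
      exact le_of_mul_le_mul_left h4 (by linarith)
    rw [abs_le]
    constructor
    · linarith
    · nlinarith [mul_nonneg hμ0 h0]
  calc l1 (p - q) ≤ ∑ b, (2 * (4 * μ * p b) + (p b - q b)) :=
        Finset.sum_le_sum fun b _ => hpt b
    _ = 8 * μ := by
        rw [Finset.sum_add_distrib, Finset.sum_sub_distrib, ← Finset.mul_sum, ← Finset.mul_sum,
          hp.2, hq.2]
        ring

/-- Stationary distributions of positive row-stochastic matrices are Lipschitz with respect to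
relative perturbations of the rows. -/
lemma stationary_perturb {d : ℕ} {Q R : Fin d → Fin d → ℝ}
    (hQ : rowStoch Q) (hR : rowStoch R) (hQp : ∀ a b, 0 < Q a b) (hRp : ∀ a b, 0 < R a b)
    {μ : Fin d → ℝ} (hμ0 : ∀ a, 0 ≤ μ a)
    (hμ : ∀ a, μ a < 1 / 2 → ∀ b, |R a b - Q a b| ≤ μ a * Q a b)
    {p q : Fin d → ℝ} (hp : p ∈ simplex d) (hq : q ∈ simplex d)
    (hpst : ∀ b, ∑ a, Q a b * p a = p b) (hqst : ∀ b, ∑ a, R a b * q a = q b) :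
    l1 (p - q) ≤ 8 * ∑ a, μ a := by
  have : NeZero d := ⟨by
    rintro rfl
    simpa using hp.2⟩
  have key : ∀ S : Finset (Fin d), ∀ r ∈ simplex d,
      (∀ b, ∑ a, (if a ∈ S then R a else Q a) b * r a = r b) →
        l1 (p - r) ≤ 8 * ∑ a ∈ S, μ a := by
    intro S
    induction S using Finset.induction_on with
    | empty =>
      intro r hr hrst
      have h := stationary_perturb_row (μ := 0) hQ hQp hQp 0 (fun _ _ => rfl) le_rfl
        (fun _ b => by simp) hp hr hpst (by simpa using hrst)
      simpa using h
    | insert a S ha ih =>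
      intro r hr hrst
      have hmix : ∀ S : Finset (Fin d), rowStoch fun a => if a ∈ S then R a else Q a := by
        intro S a
        by_cases h : a ∈ S
        · simpa [h] using hR a
        · simpa [h] using hQ a
      have hmixp : ∀ (S : Finset (Fin d)) (a b : Fin d), 0 < (if a ∈ S then R a else Q a) b := by
        intro S a b
        by_cases h : a ∈ S
        · simpa [h] using hRp a b
        · simpa [h] using hQp a b
      obtain ⟨s, hs, hsst⟩ := exists_stationary (hmix S)
      have h1 := ih s hs hsst
      have h2 := stationary_perturb_row (hmix S) (hmixp S) (hmixp (insert a S)) a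
        (fun c hc => by simp [Finset.mem_insert, hc]) (hμ0 a)
        (fun h b => by simpa [ha] using hμ a h b) hs hr hsst hrst
      rw [Finset.sum_insert ha]
      linarith [l1_sub_le p s r]
  exact key Finset.univ q hq (by simpa using hqst)

/-! ### Optimistic FTRL with the log-barrier -/

/-- Bregman divergence of the log-barrier on the simplex. -/
def barrierDiv {d : ℕ} (z y : Fin d → ℝ) : ℝ :=
  ∑ k, (z k / y k - 1 - Real.log (z k / y k))

lemma mul_sub_le_barrier_add {r σ : ℝ} (hr : 0 < r) (hσ : |σ| ≤ 1 / 2) :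
    σ * (r - 1) ≤ (r - 1 - Real.log r) + 2 * σ ^ 2 := by
  obtain ⟨h1, h2⟩ := abs_le.mp hσ
  have hpos : 0 < 1 - σ := by linarith
  have hlog1 := Real.log_le_sub_one_of_pos (mul_pos hr hpos)
  rw [Real.log_mul hr.ne' hpos.ne'] at hlog1
  have hlog2 := Real.one_sub_inv_le_log_of_pos hpos
  have hinv : (1 - σ)⁻¹ ≤ 1 + σ + 2 * σ ^ 2 := by
    rw [inv_le_iff_one_le_mul₀ hpos]
    nlinarith [mul_nonneg (sq_nonneg σ) (show 0 ≤ 1 - 2 * σ by linarith)]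
  nlinarith

lemma sq_sqrt_sub_one_le {r : ℝ} (hr : 0 < r) :
    (Real.sqrt r - 1) ^ 2 ≤ r - 1 - Real.log r := by
  have hs := Real.sqrt_pos.mpr hr
  have hsq := Real.sq_sqrt hr.le
  have h1 := Real.log_le_sub_one_of_pos hs
  rw [Real.log_sqrt hr.le] at h1
  nlinarith

lemma barrierDiv_term_nonneg {r : ℝ} (hr : 0 < r) : 0 ≤ r - 1 - Real.log r :=
  (sq_nonneg _).trans (sq_sqrt_sub_one_le hr)

lemma barrierDiv_nonneg {d : ℕ} {z y : Fin d → ℝ} (hz : ∀ k, 0 < z k) (hy : ∀ k, 0 < y k) :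
    0 ≤ barrierDiv z y :=
  Finset.sum_nonneg fun k _ => barrierDiv_term_nonneg (div_pos (hz k) (hy k))

/-- Small log-barrier divergence forces multiplicative closeness. -/
lemma abs_sub_le_of_barrierDiv {d : ℕ} {z y : Fin d → ℝ} (hz : ∀ k, 0 < z k)
    (hy : ∀ k, 0 < y k) (hsmall : Real.sqrt (8 * barrierDiv z y) < 1 / 2) (k : Fin d) :
    |z k - y k| ≤ Real.sqrt (8 * barrierDiv z y) * y k := by
  have hD := barrierDiv_nonneg hz hy
  have hr := div_pos (hz k) (hy k)
  set r := z k / y k with hrdef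
  have hterm : r - 1 - Real.log r ≤ barrierDiv z y :=
    Finset.single_le_sum
      (f := fun k => z k / y k - 1 - Real.log (z k / y k))
      (fun k _ => barrierDiv_term_nonneg (div_pos (hz k) (hy k))) (Finset.mem_univ k)
  set ρ := Real.sqrt (8 * barrierDiv z y) with hρ
  have hρsq : ρ ^ 2 = 8 * barrierDiv z y := Real.sq_sqrt (by linarith)
  have hs := Real.sqrt_pos.mpr hr
  have hsq := Real.sq_sqrt hr.le
  have h1 := sq_sqrt_sub_one_le hr
  have hρ0 : 0 ≤ ρ := Real.sqrt_nonneg _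
  set s := Real.sqrt r
  have hs32 : s ≤ 3 / 2 := by
    by_contra! h
    nlinarith
  have habs : |r - 1| ≤ ρ := by
    refine abs_le_of_sq_le_sq ?_ hρ0
    have h2 : (r - 1) ^ 2 = (s - 1) ^ 2 * (s + 1) ^ 2 := by rw [← hsq]; ring
    have h3 : (s + 1) ^ 2 ≤ 8 := by nlinarith
    nlinarith [mul_le_mul_of_nonneg_left h3 (sq_nonneg (s - 1))]
  have hzk : z k - y k = (r - 1) * y k := by
    rw [hrdef]
    field_simp [(hy k).ne']
  rw [hzk, abs_mul, abs_of_pos (hy k)]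
  exact mul_le_mul_of_nonneg_right habs (hy k).le

lemma logBarrier_sub {d : ℕ} {z y : Fin d → ℝ} (hz : ∀ k, 0 < z k) (hy : ∀ k, 0 < y k) :
    logBarrier y - logBarrier z = ∑ k, Real.log (z k / y k) := by
  simp only [logBarrier, Real.log_div (hz _).ne' (hy _).ne', Finset.sum_sub_distrib]
  ring

/-- First-order optimality for the log-barrier regularized problem, in Bregman form. -/
lemma oftrl_optimality {d : ℕ} {G y : Fin d → ℝ} {η : ℝ} (hη : 0 < η)
    (hy : y ∈ simplex d) (hyp : ∀ k, 0 < y k)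
    (hopt : ∀ z ∈ simplex d, (∀ k, 0 < z k) →
      inp z G - logBarrier z / η ≤ inp y G - logBarrier y / η)
    {z : Fin d → ℝ} (hz : z ∈ simplex d) (hzp : ∀ k, 0 < z k) :
    inp z G - logBarrier z / η + barrierDiv z y / η ≤ inp y G - logBarrier y / η := by
  have hfirst : ∀ l ∈ Set.Ioo (0 : ℝ) 1,
      inp (z - y) G + (∑ k, (z k / y k - 1) / (1 + l * (z k / y k - 1))) / η ≤ 0 := by
    intro l hl
    have hwp : ∀ k, 0 < y k + l * (z k - y k) := fun k => by
      nlinarith [mul_pos hl.1 (hzp k), mul_pos (sub_pos.mpr hl.2) (hyp k)]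
    have hw : (fun k => y k + l * (z k - y k)) ∈ simplex d := by
      refine ⟨fun k => (hwp k).le, ?_⟩
      rw [Finset.sum_add_distrib, ← Finset.mul_sum, Finset.sum_sub_distrib, hz.2, hy.2]
      ring
    have h := hopt _ hw hwp
    have hinp : inp (fun k => y k + l * (z k - y k)) G = inp y G + l * inp (z - y) G := by
      simp only [inp, Finset.mul_sum, ← Finset.sum_add_distrib, Pi.sub_apply]
      exact Finset.sum_congr rfl fun k _ => by ring
    have hlog : l * ∑ k, (z k / y k - 1) / (1 + l * (z k / y k - 1))
        ≤ logBarrier y - logBarrier (fun k => y k + l * (z k - y k)) := by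
      rw [logBarrier_sub hwp hyp, Finset.mul_sum]
      refine Finset.sum_le_sum fun k _ => ?_
      have hy' := hyp k
      have heq : (y k + l * (z k - y k)) / y k = 1 + l * (z k / y k - 1) := by
        field_simp
      have hpos := div_pos (hwp k) hy'
      have h1 := Real.one_sub_inv_le_log_of_pos hpos
      rw [heq] at h1 hpos ⊢
      refine le_trans (le_of_eq ?_) h1
      rw [← mul_div_assoc, div_eq_iff hpos.ne', sub_mul, inv_mul_cancel₀ hpos.ne']
      ring
    rw [hinp] at h
    have h2 := div_le_div_of_nonneg_right hlog hη.le
    rw [sub_div] at h2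
    have h3 : l * (inp (z - y) G
        + (∑ k, (z k / y k - 1) / (1 + l * (z k / y k - 1))) / η) ≤ 0 := by
      rw [mul_add, ← mul_div_assoc]
      linarith
    exact nonpos_of_mul_nonpos_right h3 hl.1
  have hlim : inp (z - y) G + (∑ k, (z k / y k - 1)) / η ≤ 0 := by
    have htend : Filter.Tendsto (fun l : ℝ => inp (z - y) G
        + (∑ k, (z k / y k - 1) / (1 + l * (z k / y k - 1))) / η)
        (nhdsWithin 0 (Set.Ioi 0)) (nhds (inp (z - y) G + (∑ k, (z k / y k - 1)) / η)) := by
      have hc : ContinuousAt (fun l : ℝ => inp (z - y) G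
          + (∑ k, (z k / y k - 1) / (1 + l * (z k / y k - 1))) / η) 0 := by
        refine continuousAt_const.add (ContinuousAt.div_const ?_ η)
        refine tendsto_finsetSum _ fun k _ => ?_
        exact ContinuousAt.div (by fun_prop) (by fun_prop) (by simp)
      have h := hc.tendsto
      simp only [zero_mul, add_zero, div_one] at h
      exact h.mono_left nhdsWithin_le_nhds
    refine le_of_tendsto htend ?_
    filter_upwards [Ioo_mem_nhdsGT (show (0 : ℝ) < 1 by norm_num)] with l hl
    exact hfirst l hl
  have hD : barrierDiv z y
      = ∑ k, (z k / y k - 1) - (logBarrier y - logBarrier z) := by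
    rw [logBarrier_sub hzp hyp, ← Finset.sum_sub_distrib]
    rfl
  rw [hD, sub_div, sub_div]
  rw [inp_sub_left] at hlim
  linarith

/-- The log-barrier is minimized over the simplex at the uniform distribution. -/
lemma mul_log_le_logBarrier {d : ℕ} {y : Fin d → ℝ} (hy : y ∈ simplex d)
    (hyp : ∀ k, 0 < y k) : d * Real.log d ≤ logBarrier y := by
  have hk : ∀ k ∈ (Finset.univ : Finset (Fin d)), Real.log (y k) ≤ d * y k - 1 - Real.log d := by
    intro k _
    have hd : (0 : ℝ) < d := by exact_mod_cast k.pos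
    have h := Real.log_le_sub_one_of_pos (mul_pos hd (hyp k))
    rw [Real.log_mul hd.ne' (hyp k).ne'] at h
    linarith
  have h := Finset.sum_le_sum hk
  rw [Finset.sum_sub_distrib, Finset.sum_sub_distrib, ← Finset.mul_sum, hy.2] at h
  simp only [Finset.sum_const, Finset.card_univ, Fintype.card_fin, nsmul_eq_mul] at h
  simp only [logBarrier]
  linarith

/-- Regret of optimistic FTRL with the log-barrier and nonincreasing learning rates. -/
lemma oftrl_regret {d N : ℕ} {g y : ℕ → Fin d → ℝ} {η : ℕ → ℝ}
    (hη : ∀ t, 0 < η t) (hηa : ∀ t, η (t + 1) ≤ η t)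
    (hy : ∀ t ∈ Finset.Icc 1 (N + 1), y t ∈ simplex d ∧ (∀ k, 0 < y t k) ∧
      ∀ z ∈ simplex d, (∀ k, 0 < z k) →
        inp z (g (t - 1) + ∑ s ∈ Finset.Icc 1 (t - 1), g s) - logBarrier z / η t
          ≤ inp (y t) (g (t - 1) + ∑ s ∈ Finset.Icc 1 (t - 1), g s) - logBarrier (y t) / η t)
    {z : Fin d → ℝ} (hz : z ∈ simplex d) (hzp : ∀ k, 0 < z k) :
    ∑ t ∈ Finset.Icc 1 (N + 1), inp (z - y t) (g t)
      ≤ (logBarrier z - d * Real.log d) / η (N + 1) + 2 * linf (g (N + 1) - g N)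
        + ∑ s ∈ Finset.Icc 1 N, (inp (y (s + 1) - y s) (g s - g (s - 1))
            - barrierDiv (y (s + 1)) (y s) / η s) := by
  have hpot : ∀ j ≤ N, inp (y (j + 1)) (∑ s ∈ Finset.Icc 1 j, g s)
        - (logBarrier (y (j + 1)) - d * Real.log d) / η (j + 1)
      ≤ ∑ s ∈ Finset.Icc 1 j, (inp (y s) (g s) + (inp (y (s + 1) - y s) (g s - g (s - 1))
            - barrierDiv (y (s + 1)) (y s) / η s)) := by
    intro j
    induction j with
    | zero =>
      intro _
      obtain ⟨h1, h2, -⟩ := hy 1 (by simp)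
      have h3 : 0 ≤ (logBarrier (y 1) - d * Real.log d) / η 1 :=
        div_nonneg (sub_nonneg.mpr (mul_log_le_logBarrier h1 h2)) (hη 1).le
      simp only [zero_add, Finset.Icc_eq_empty_of_lt zero_lt_one, Finset.sum_empty]
      simp only [inp, Pi.zero_apply, mul_zero, Finset.sum_const_zero]
      linarith
    | succ j ih =>
      intro hj
      have ih' := ih (by omega)
      obtain ⟨ha1, ha2, ha3⟩ := hy (j + 1) (by simp; omega)
      obtain ⟨hb1, hb2, -⟩ := hy (j + 1 + 1) (by simp; omega)
      have hbreg := oftrl_optimality (hη (j + 1)) ha1 ha2 ha3 hb1 hb2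
      simp only [Nat.add_sub_cancel] at hbreg
      rw [Finset.sum_Icc_succ_top (by omega), Finset.sum_Icc_succ_top (by omega)]
      have hψ : 0 ≤ logBarrier (y (j + 1 + 1)) - d * Real.log d :=
        sub_nonneg.mpr (mul_log_le_logBarrier hb1 hb2)
      have hmono : (logBarrier (y (j + 1 + 1)) - d * Real.log d) / η (j + 1)
          ≤ (logBarrier (y (j + 1 + 1)) - d * Real.log d) / η (j + 1 + 1) :=
        div_le_div_of_nonneg_left hψ (hη _) (hηa _)
      simp only [Nat.add_sub_cancel, inp_add_right, inp_sub_left, inp_sub_right, sub_div]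
        at hbreg ih' hmono ⊢
      linarith
  have hlast := hpot N le_rfl
  obtain ⟨ha1, ha2, ha3⟩ := hy (N + 1) (by simp)
  have hcmp := ha3 z hz hzp
  have hcorr : inp (z - y (N + 1)) (g (N + 1) - g N) ≤ 2 * linf (g (N + 1) - g N) :=
    (le_abs_self _).trans ((abs_inp_le _ _).trans
      (mul_le_mul_of_nonneg_right (l1_sub_le_two hz ha1) (linf_nonneg _)))
  rw [Finset.sum_Icc_succ_top (by omega)]
  rw [Finset.sum_add_distrib] at hlast
  have hzsum := inp_sum_right (Finset.Icc 1 N) z g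
  have hsplit : ∑ t ∈ Finset.Icc 1 N, inp (z - y t) (g t)
      = inp z (∑ s ∈ Finset.Icc 1 N, g s) - ∑ s ∈ Finset.Icc 1 N, inp (y s) (g s) := by
    rw [hzsum, ← Finset.sum_sub_distrib]
    exact Finset.sum_congr rfl fun t _ => inp_sub_left _ _ _
  rw [hsplit]
  simp only [Nat.add_sub_cancel, inp_add_right] at hcmp
  simp only [inp_sub_left z, inp_sub_right _ (g (N + 1)), sub_div] at hcorr hlast ⊢
  linarith

lemma inp_sub_barrierDiv_le {d : ℕ} {y z w : Fin d → ℝ} {η : ℝ} (hη : 0 < η)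
    (hy : y ∈ simplex d) (hyp : ∀ k, 0 < y k) (hzp : ∀ k, 0 < z k)
    (hw : η * linf w ≤ 1 / 4) :
    inp (z - y) w ≤ barrierDiv z y / (2 * η) + 4 * η * linf w ^ 2 := by
  have hk : ∀ k ∈ (Finset.univ : Finset (Fin d)), (z k - y k) * w k
      ≤ (z k / y k - 1 - Real.log (z k / y k)) / (2 * η) + 4 * η * linf w ^ 2 * y k := by
    intro k _
    have hyk := hyp k
    have hy1 := simplex_le_one hy k
    have hwk := abs_le_linf w k
    have hσ : |2 * η * (y k * w k)| ≤ 1 / 2 := by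
      rw [abs_mul, abs_mul (y k), abs_of_pos hyk, abs_of_pos (by linarith : 0 < 2 * η)]
      have h1 : y k * |w k| ≤ 1 * linf w :=
        mul_le_mul hy1 hwk (abs_nonneg _) zero_le_one
      nlinarith
    have h := mul_sub_le_barrier_add (div_pos (hzp k) hyk) hσ
    have h2 : (y k * w k) ^ 2 ≤ linf w ^ 2 * y k := by
      have h3 : w k ^ 2 ≤ linf w ^ 2 := sq_le_sq' (neg_le_of_abs_le hwk) (le_of_abs_le hwk)
      nlinarith [mul_nonneg (mul_nonneg hyk.le (sub_nonneg.mpr hy1)) (sq_nonneg (w k)),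
        mul_le_mul_of_nonneg_right h3 hyk.le]
    have h4 : 2 * η * (y k * w k) * (z k / y k - 1) = 2 * η * ((z k - y k) * w k) := by
      field_simp
    rw [h4] at h
    have h5 : (z k - y k) * w k ≤ ((z k / y k - 1 - Real.log (z k / y k))
        + 2 * (2 * η * (y k * w k)) ^ 2) / (2 * η) := by
      rw [le_div_iff₀ (by linarith)]
      linarith
    have h6 : 2 * (2 * η * (y k * w k)) ^ 2 / (2 * η) = 4 * η * (y k * w k) ^ 2 := by
      field_simp
      ring
    rw [add_div, h6] at h5
    nlinarith
  have h := Finset.sum_le_sum hk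
  rw [Finset.sum_add_distrib, ← Finset.mul_sum, hy.2, ← Finset.sum_div] at h
  simpa [inp, barrierDiv] using h

lemma sum_div_sqrt_le {w : ℕ → ℝ} (N : ℕ) (hw0 : ∀ s ∈ Finset.Icc 1 N, 0 ≤ w s)
    (hw4 : ∀ s ∈ Finset.Icc 1 N, w s ≤ 4) :
    ∑ s ∈ Finset.Icc 1 N, w s / Real.sqrt (4 + ∑ r ∈ Finset.Icc 1 (s - 1), w r)
      ≤ 3 * Real.sqrt (4 + ∑ s ∈ Finset.Icc 1 N, w s) := by
  induction N with
  | zero => simp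
  | succ N ih =>
    have hsub : ∀ s ∈ Finset.Icc 1 N, s ∈ Finset.Icc 1 (N + 1) := fun s hs => by
      simp at hs ⊢; omega
    have ih' := ih (fun s hs => hw0 s (hsub s hs)) (fun s hs => hw4 s (hsub s hs))
    rw [Finset.sum_Icc_succ_top (by omega), Finset.sum_Icc_succ_top (by omega),
      Nat.add_sub_cancel]
    have hV : 0 ≤ ∑ s ∈ Finset.Icc 1 N, w s := Finset.sum_nonneg fun s hs => hw0 s (hsub s hs)
    have h0 := hw0 (N + 1) (by simp)
    have h4 := hw4 (N + 1) (by simp)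
    set V := ∑ s ∈ Finset.Icc 1 N, w s
    set v := w (N + 1)
    have hs2 : Real.sqrt (4 + V) ^ 2 = 4 + V := Real.sq_sqrt (by linarith)
    have hr2 : Real.sqrt (4 + (V + v)) ^ 2 = 4 + (V + v) := Real.sq_sqrt (by linarith)
    have hs : 0 < Real.sqrt (4 + V) := Real.sqrt_pos.mpr (by linarith)
    have hr : 0 < Real.sqrt (4 + (V + v)) := Real.sqrt_pos.mpr (by linarith)
    set s := Real.sqrt (4 + V)
    set r := Real.sqrt (4 + (V + v))
    have hsr : s ≤ r := by nlinarith
    have hr2s : r ≤ 2 * s := by nlinarith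
    have hstep : v / s ≤ 3 * (r - s) := by
      rw [div_le_iff₀ hs]
      nlinarith
    linarith

/-- Regret of one expert with the adaptive learning rate. -/
lemma expert_regret {d n N : ℕ} (hd : 1 ≤ d) (hn : 1 ≤ n) (hN : 1 ≤ N)
    {g y : ℕ → Fin d → ℝ} {η : ℕ → ℝ}
    (hW : ∀ s ∈ Finset.Icc 1 N, linf (g s - g (s - 1)) ≤ 2)
    (hη : ∀ t, η t = min
        (Real.sqrt (((d : ℝ) * Real.log (N + 1 : ℕ) / 8) /
          (4 + ∑ s ∈ Finset.Icc 1 (t - 1), (linf (g s - g (s - 1))) ^ 2)))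
        (1 / (256 * (n : ℝ) * Real.sqrt d)))
    (hy : ∀ t ∈ Finset.Icc 1 (N + 1), y t ∈ simplex d ∧ (∀ k, 0 < y t k) ∧
      ∀ z ∈ simplex d, (∀ k, 0 < z k) →
        inp z (g (t - 1) + ∑ s ∈ Finset.Icc 1 (t - 1), g s) - logBarrier z / η t
          ≤ inp (y t) (g (t - 1) + ∑ s ∈ Finset.Icc 1 (t - 1), g s) - logBarrier (y t) / η t)
    {z : Fin d → ℝ} (hz : z ∈ simplex d) :
    ∑ t ∈ Finset.Icc 1 (N + 1), inp (z - y t) (g t)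
      ≤ 256 * n * (d * Real.sqrt d) * Real.log (N + 1 : ℕ)
        + 8 * Real.sqrt (d * Real.log (N + 1 : ℕ)
            * (4 + ∑ s ∈ Finset.Icc 1 N, linf (g s - g (s - 1)) ^ 2))
        + 2 * linf (g (N + 1) - g N)
        + 2 / (N + 1 : ℕ) * ∑ t ∈ Finset.Icc 1 (N + 1), linf (g t)
        - 128 * n * Real.sqrt d * ∑ s ∈ Finset.Icc 1 N, barrierDiv (y (s + 1)) (y s) := by
  have hd0 : (0 : ℝ) < d := by exact_mod_cast hd
  have hn1 : (1 : ℝ) ≤ n := by exact_mod_cast hn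
  have hT1 : (1 : ℝ) < (N + 1 : ℕ) := by exact_mod_cast Nat.lt_succ_of_le hN
  have hL : 0 < Real.log (N + 1 : ℕ) := Real.log_pos hT1
  set T : ℝ := ((N + 1 : ℕ) : ℝ) with hTdef
  set L := Real.log T
  set X := (d : ℝ) * L with hX
  have hX0 : 0 < X := mul_pos hd0 hL
  have hsd : 1 ≤ Real.sqrt d := Real.one_le_sqrt.mpr (by exact_mod_cast hd)
  have hB : 0 < 256 * (n : ℝ) * Real.sqrt d := by positivity
  have hYpos : ∀ j, 0 < 4 + ∑ s ∈ Finset.Icc 1 j, linf (g s - g (s - 1)) ^ 2 := fun j => by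
    positivity
  have hηpos : ∀ t, 0 < η t := by
    intro t
    rw [hη]
    exact lt_min (Real.sqrt_pos.mpr (div_pos (by linarith) (hYpos _))) (by positivity)
  have hηanti : ∀ t, η (t + 1) ≤ η t := by
    intro t
    rw [hη, hη]
    refine min_le_min_right _ (Real.sqrt_le_sqrt ?_)
    refine div_le_div_of_nonneg_left (by linarith) (hYpos _) ?_
    refine add_le_add_right (Finset.sum_le_sum_of_subset_of_nonneg ?_ fun _ _ _ => sq_nonneg _) _
    exact Finset.Icc_subset_Icc_right (by omega)
  have hηB : ∀ t, η t ≤ 1 / (256 * (n : ℝ) * Real.sqrt d) := fun t => by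
    rw [hη]; exact min_le_right _ _
  have hη256 : ∀ t, η t ≤ 1 / 256 := fun t => by
    refine (hηB t).trans (one_div_le_one_div_of_le (by norm_num) ?_)
    nlinarith
  -- the comparator is moved into the interior
  set z' : Fin d → ℝ := fun k => (1 - 1 / T) * z k + 1 / (d * T) with hz'
  have hTpos : 0 < T := by linarith
  have hT' : 0 ≤ 1 - 1 / T := by
    rw [sub_nonneg, div_le_one hTpos]
    exact hT1.le
  have hz'low : ∀ k, 1 / (d * T) ≤ z' k := fun k => by
    have := mul_nonneg hT' (hz.1 k)
    simp only [hz']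
    linarith
  have hzpos : ∀ k, 0 < z' k := fun k => lt_of_lt_of_le (by positivity) (hz'low k)
  have hzs : z' ∈ simplex d := by
    refine ⟨fun k => (hzpos k).le, ?_⟩
    simp only [hz', Finset.sum_add_distrib, ← Finset.mul_sum, hz.2, Finset.sum_const,
      Finset.card_univ, Fintype.card_fin, nsmul_eq_mul]
    field_simp
    ring
  have hψ : logBarrier z' - d * Real.log d ≤ X := by
    have hk : ∀ k ∈ (Finset.univ : Finset (Fin d)), -Real.log d - L ≤ Real.log (z' k) := by
      intro k _
      have h := Real.log_le_log (by positivity) (hz'low k)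
      rw [one_div, Real.log_inv, Real.log_mul hd0.ne' hTpos.ne'] at h
      linarith
    have h := Finset.sum_le_sum hk
    simp only [Finset.sum_const, Finset.card_univ, Fintype.card_fin, nsmul_eq_mul] at h
    simp only [logBarrier, hX]
    linarith
  have hreg := oftrl_regret hηpos hηanti hy hzs hzpos
  -- cost of moving the comparator
  have hmove : ∀ t ∈ Finset.Icc 1 (N + 1),
      inp (z - y t) (g t) ≤ inp (z' - y t) (g t) + 2 / T * linf (g t) := by
    intro t _
    have h1 : inp (z - z') (g t) ≤ 2 / T * linf (g t) := by
      refine (le_abs_self _).trans ((abs_inp_le _ _).trans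
        (mul_le_mul_of_nonneg_right ?_ (linf_nonneg _)))
      have hk : ∀ k ∈ (Finset.univ : Finset (Fin d)),
          |(z - z') k| ≤ 1 / T * z k + 1 / (d * T) := by
        intro k _
        have h0 := hz.1 k
        have h2 : 0 ≤ 1 / T * z k := by positivity
        have h3 : 0 ≤ 1 / (d * T) := by positivity
        simp only [Pi.sub_apply, hz', abs_le]
        constructor <;> linarith
      refine (Finset.sum_le_sum hk).trans (le_of_eq ?_)
      simp only [Finset.sum_add_distrib, ← Finset.mul_sum, hz.2, Finset.sum_const,
        Finset.card_univ, Fintype.card_fin, nsmul_eq_mul]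
      field_simp
      ring
    simp only [inp_sub_left] at h1 ⊢
    linarith
  have hmoveS := Finset.sum_le_sum hmove
  rw [Finset.sum_add_distrib, ← Finset.mul_sum] at hmoveS
  set Y := 4 + ∑ s ∈ Finset.Icc 1 N, linf (g s - g (s - 1)) ^ 2 with hYdef
  have hY0 : 0 < Y := hYpos N
  -- penalty term
  have hpen : (logBarrier z' - d * Real.log d) / η (N + 1)
      ≤ 256 * n * (d * Real.sqrt d) * L + 3 * Real.sqrt (X * Y) := by
    have h1 : (logBarrier z' - d * Real.log d) / η (N + 1) ≤ X / η (N + 1) :=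
      div_le_div_of_nonneg_right hψ (hηpos _).le
    refine h1.trans ?_
    have hapos : 0 < Real.sqrt (X / 8 / Y) := Real.sqrt_pos.mpr (by positivity)
    have h2 : X / Real.sqrt (X / 8 / Y) ≤ 3 * Real.sqrt (X * Y) := by
      have ha2 : Real.sqrt (X / 8 / Y) ^ 2 = X / 8 / Y := Real.sq_sqrt (by positivity)
      set a := Real.sqrt (X / 8 / Y)
      have hXa : X = 8 * Y * a ^ 2 := by
        rw [ha2]
        field_simp
      rw [div_le_iff₀ hapos]
      have h3 : 8 / 3 * Y * a ≤ Real.sqrt (X * Y) := by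
        refine Real.le_sqrt_of_sq_le ?_
        rw [hXa]
        nlinarith [sq_nonneg (Y * a)]
      nlinarith [mul_le_mul_of_nonneg_right h3 hapos.le]
    have h4 : 0 ≤ 256 * n * (d * Real.sqrt d) * L := by positivity
    have hmin := hη (N + 1)
    rw [Nat.add_sub_cancel] at hmin
    rcases min_choice (Real.sqrt (X / 8 / Y)) (1 / (256 * (n : ℝ) * Real.sqrt d)) with h | h
    · rw [hmin, h]
      linarith
    · rw [hmin, h]
      have h5 : X / (1 / (256 * (n : ℝ) * Real.sqrt d)) = 256 * n * (d * Real.sqrt d) * L := by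
        rw [hX]
        field_simp
      rw [h5]
      linarith [Real.sqrt_nonneg (X * Y)]
  -- stability term
  have hstab : ∀ s ∈ Finset.Icc 1 N, inp (y (s + 1) - y s) (g s - g (s - 1))
        - barrierDiv (y (s + 1)) (y s) / η s
      ≤ 4 * Real.sqrt (X / 8) * (linf (g s - g (s - 1)) ^ 2
          / Real.sqrt (4 + ∑ r ∈ Finset.Icc 1 (s - 1), linf (g r - g (r - 1)) ^ 2))
        - 128 * n * Real.sqrt d * barrierDiv (y (s + 1)) (y s) := by
    intro s hs
    have hs' := Finset.mem_Icc.mp hs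
    obtain ⟨ha1, ha2, -⟩ := hy s (by simp; omega)
    obtain ⟨-, hb2, -⟩ := hy (s + 1) (by simp; omega)
    have hw : η s * linf (g s - g (s - 1)) ≤ 1 / 4 := by
      have := mul_le_mul (hη256 s) (hW s hs) (linf_nonneg _) (by norm_num)
      linarith
    have h1 := inp_sub_barrierDiv_le (hηpos s) ha1 ha2 hb2 hw
    have hD := barrierDiv_nonneg hb2 ha2
    have h2 : 128 * n * Real.sqrt d * barrierDiv (y (s + 1)) (y s)
        ≤ barrierDiv (y (s + 1)) (y s) / (2 * η s) := by
      rw [le_div_iff₀ (by linarith [hηpos s])]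
      have h3 := (le_div_iff₀ hB).mp (hηB s)
      nlinarith [mul_le_mul_of_nonneg_left h3 hD]
    have h4 : barrierDiv (y (s + 1)) (y s) / η s
        = 2 * (barrierDiv (y (s + 1)) (y s) / (2 * η s)) := by
      have := (hηpos s).ne'
      field_simp
    have h5 : η s ≤ Real.sqrt (X / 8)
        / Real.sqrt (4 + ∑ r ∈ Finset.Icc 1 (s - 1), linf (g r - g (r - 1)) ^ 2) := by
      rw [← Real.sqrt_div (by positivity), hη s]
      exact min_le_left _ _
    have h6 := mul_le_mul_of_nonneg_right h5 (sq_nonneg (linf (g s - g (s - 1))))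
    rw [div_mul_eq_mul_div] at h6
    rw [← mul_div_assoc, mul_assoc 4, mul_div_assoc]
    linarith
  have hstabS := Finset.sum_le_sum hstab
  rw [Finset.sum_sub_distrib (fun s => 4 * _ * _), ← Finset.mul_sum, ← Finset.mul_sum] at hstabS
  have hada := sum_div_sqrt_le (w := fun s => linf (g s - g (s - 1)) ^ 2) N
    (fun s _ => sq_nonneg _) (fun s hs => by
      have := hW s hs
      have := linf_nonneg (g s - g (s - 1))
      nlinarith)
  have hfin : 4 * Real.sqrt (X / 8) * (3 * Real.sqrt Y) ≤ 5 * Real.sqrt (X * Y) := by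
    rw [Real.sqrt_mul hX0.le]
    have h1 : Real.sqrt (X / 8) ≤ 5 / 12 * Real.sqrt X := by
      rw [Real.sqrt_le_left (by positivity), mul_pow, Real.sq_sqrt hX0.le]
      linarith
    nlinarith [mul_le_mul_of_nonneg_right h1 (Real.sqrt_nonneg Y)]
  have hada' := mul_le_mul_of_nonneg_left hada
    (show 0 ≤ 4 * Real.sqrt (X / 8) by positivity)
  linarith

/-! ### Swap regret of one player -/

lemma sum_Icc_succ_eq_add_shift (f : ℕ → ℝ) (N : ℕ) :
    ∑ s ∈ Finset.Icc 1 (N + 1), f s = f 1 + ∑ s ∈ Finset.Icc 1 N, f (s + 1) := by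
  induction N with
  | zero => simp
  | succ N ih =>
    rw [Finset.sum_Icc_succ_top (by omega), ih, Finset.sum_Icc_succ_top (by omega)]
    ring

lemma sum_Icc_le_succ {f : ℕ → ℝ} (hf : ∀ s, 0 ≤ f s) (N : ℕ) :
    ∑ s ∈ Finset.Icc 1 N, f s ≤ ∑ s ∈ Finset.Icc 1 (N + 1), f s := by
  rw [Finset.sum_Icc_succ_top (by omega)]
  linarith [hf (N + 1)]

lemma sum_Icc_shift_le_succ {f : ℕ → ℝ} (hf : ∀ s, 0 ≤ f s) (N : ℕ) :
    ∑ s ∈ Finset.Icc 1 N, f (s + 1) ≤ ∑ s ∈ Finset.Icc 1 (N + 1), f s := by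
  rw [sum_Icc_succ_eq_add_shift]
  linarith [hf 1]

/-- Swap regret decomposes into the regrets of the experts. -/
lemma inp_mvec_sub_eq_sum {d : ℕ} {p v : Fin d → ℝ} {Q M : Fin d → Fin d → ℝ}
    (hst : ∀ b, ∑ a, Q a b * p a = p b) :
    inp p (mvec M v - v) = ∑ a, inp (M a - Q a) (p a • v) := by
  have h1 : inp p v = ∑ a, p a * inp (Q a) v := by
    simp only [inp, Finset.mul_sum]
    rw [Finset.sum_comm]
    refine Finset.sum_congr rfl fun b _ => ?_
    rw [← hst b, Finset.sum_mul]
    exact Finset.sum_congr rfl fun a _ => by ring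
  rw [inp_sub_right, h1]
  simp only [inp_sub_left, inp_smul_right, mul_sub, Finset.sum_sub_distrib]
  rfl

lemma linf_weighted_sub_le {d : ℕ} {p q : ℝ} (hp : 0 ≤ p) {v w : Fin d → ℝ}
    (hw : linf w ≤ 1) : linf (p • v - q • w) ≤ p * linf (v - w) + |p - q| := by
  have h : p • v - q • w = p • (v - w) + (p - q) • w := by
    rw [smul_sub, sub_smul]
    abel
  rw [h]
  refine (linf_add_le _ _).trans ?_
  rw [linf_smul, linf_smul, abs_of_nonneg hp]
  nlinarith [abs_nonneg (p - q)]

lemma sum_linf_weighted_sub_sq_le {d : ℕ} {p q v w : Fin d → ℝ} (hp : p ∈ simplex d)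
    (hw : linf w ≤ 1) :
    ∑ a, linf (p a • v - q a • w) ^ 2 ≤ 2 * linf (v - w) ^ 2 + 2 * l1 (p - q) ^ 2 := by
  have hk : ∀ a ∈ (Finset.univ : Finset (Fin d)), linf (p a • v - q a • w) ^ 2
      ≤ 2 * linf (v - w) ^ 2 * p a ^ 2 + 2 * (p - q) a ^ 2 := by
    intro a _
    have h := linf_weighted_sub_le (q := q a) (v := v) (hp.1 a) hw
    have h0 := linf_nonneg (p a • v - q a • w)
    have h2 := pow_le_pow_left₀ h0 h 2
    have h3 : (p - q) a ^ 2 = |p a - q a| ^ 2 := by simp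
    rw [h3]
    nlinarith [sq_nonneg (p a * linf (v - w) - |p a - q a|)]
  refine (Finset.sum_le_sum hk).trans ?_
  rw [Finset.sum_add_distrib, ← Finset.mul_sum, ← Finset.mul_sum]
  have h1 := sum_sq_simplex_le_one hp
  have h2 := sum_sq_le_l1_sq (p - q)
  nlinarith [sq_nonneg (linf (v - w))]

lemma linf_smul_le_of_linf_le_one {d : ℕ} {p : ℝ} (hp : 0 ≤ p) {v : Fin d → ℝ}
    (hv : linf v ≤ 1) : linf (p • v) ≤ p := by
  rw [linf_smul, abs_of_nonneg hp]
  nlinarith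

/-- Swap regret of one player against the observed utilities, with the negative path-length
term retained. -/
lemma player_swap_regret {d n N : ℕ} (hd : 1 ≤ d) (hn : 1 ≤ n) (hN : 2 ≤ N)
    {p v : ℕ → Fin d → ℝ} {g y : Fin d → ℕ → Fin d → ℝ} {η : Fin d → ℕ → ℝ}
    (hp : ∀ t ∈ Finset.Icc 1 (N + 1), p t ∈ simplex d)
    (hv : ∀ t ∈ Finset.Icc 1 (N + 1), linf (v t) ≤ 1)
    (hg0 : ∀ a, g a 0 = 0) (hg : ∀ a s, 1 ≤ s → g a s = p s a • v s)
    (hη : ∀ a t, η a t = min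
        (Real.sqrt (((d : ℝ) * Real.log (N + 1 : ℕ) / 8) /
          (4 + ∑ s ∈ Finset.Icc 1 (t - 1), (linf (g a s - g a (s - 1))) ^ 2)))
        (1 / (256 * (n : ℝ) * Real.sqrt d)))
    (hy : ∀ a, ∀ t ∈ Finset.Icc 1 (N + 1), y a t ∈ simplex d ∧ (∀ k, 0 < y a t k) ∧
      ∀ z ∈ simplex d, (∀ k, 0 < z k) →
        inp z (g a (t - 1) + ∑ s ∈ Finset.Icc 1 (t - 1), g a s) - logBarrier z / η a t
          ≤ inp (y a t) (g a (t - 1) + ∑ s ∈ Finset.Icc 1 (t - 1), g a s)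
            - logBarrier (y a t) / η a t)
    (hst : ∀ t ∈ Finset.Icc 1 (N + 1), ∀ b, ∑ a, y a t b * p t a = p t b)
    {M : Fin d → Fin d → ℝ} (hM : rowStoch M) :
    ∑ t ∈ Finset.Icc 1 (N + 1), inp (p t) (mvec M (v t) - v t)
      ≤ 278 * n * (d ^ 2 * Real.sqrt d) * Real.log (N + 1 : ℕ)
        + 8 * d * Real.sqrt (Real.log (N + 1 : ℕ)
            * ∑ s ∈ Finset.Icc 1 N, ∑ a, linf (g a s - g a (s - 1)) ^ 2)
        - n / (4 * Real.sqrt d) * ∑ s ∈ Finset.Icc 1 N, l1 (p (s + 1) - p s) ^ 2 := by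
  have hd1 : (1 : ℝ) ≤ d := by exact_mod_cast hd
  have hn1 : (1 : ℝ) ≤ n := by exact_mod_cast hn
  have hsd : 1 ≤ Real.sqrt d := Real.one_le_sqrt.mpr hd1
  have hsd2 : Real.sqrt d ^ 2 = d := Real.sq_sqrt (by linarith)
  have hT3 : (3 : ℝ) ≤ (N + 1 : ℕ) := by exact_mod_cast Nat.succ_le_succ hN
  have hL1 : 1 ≤ Real.log (N + 1 : ℕ) := by
    rw [Real.le_log_iff_exp_le (by linarith)]
    linarith [Real.exp_one_lt_d9]
  have hgle : ∀ a, ∀ s ∈ Finset.Icc 1 (N + 1), linf (g a s) ≤ p s a := fun a s hs => by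
    rw [hg a s (Finset.mem_Icc.mp hs).1]
    exact linf_smul_le_of_linf_le_one ((hp s hs).1 a) (hv s hs)
  have hgle1 : ∀ a s, s ≤ N + 1 → linf (g a s) ≤ 1 := fun a s hs => by
    rcases Nat.eq_zero_or_pos s with rfl | h
    · rw [hg0, linf_zero]
      exact zero_le_one
    · have hs' := Finset.mem_Icc.mpr ⟨h, hs⟩
      exact (hgle a s hs').trans (simplex_le_one (hp s hs') a)
  have hW : ∀ a, ∀ s ∈ Finset.Icc 1 N, linf (g a s - g a (s - 1)) ≤ 2 := fun a s hs => by
    have h := Finset.mem_Icc.mp hs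
    linarith [linf_sub_le (g a s) (g a (s - 1)), hgle1 a s (by omega), hgle1 a (s - 1) (by omega)]
  have hexp := fun a => expert_regret hd hn (by omega : 1 ≤ N) (hW a) (hη a) (hy a) (hM a)
  have hdec : ∑ t ∈ Finset.Icc 1 (N + 1), inp (p t) (mvec M (v t) - v t)
      = ∑ a, ∑ t ∈ Finset.Icc 1 (N + 1), inp (M a - y a t) (g a t) := by
    rw [Finset.sum_comm]
    refine Finset.sum_congr rfl fun t ht => ?_
    rw [inp_mvec_sub_eq_sum (Q := fun a => y a t) (hst t ht)]
    exact Finset.sum_congr rfl fun a _ => by rw [hg a t (Finset.mem_Icc.mp ht).1]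
  rw [hdec]
  refine (Finset.sum_le_sum fun a _ => hexp a).trans ?_
  simp only [Finset.sum_add_distrib, Finset.sum_sub_distrib, ← Finset.mul_sum,
    Finset.sum_const, Finset.card_univ, Fintype.card_fin, nsmul_eq_mul]
  set T : ℝ := ((N + 1 : ℕ) : ℝ)
  set L := Real.log T
  have hsL : 1 ≤ Real.sqrt L := Real.one_le_sqrt.mpr hL1
  have hsL2 : Real.sqrt L ^ 2 = L := Real.sq_sqrt (by linarith)
  have hcomm : ∑ s ∈ Finset.Icc 1 N, ∑ a, linf (g a s - g a (s - 1)) ^ 2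
      = ∑ a, ∑ s ∈ Finset.Icc 1 N, linf (g a s - g a (s - 1)) ^ 2 := Finset.sum_comm
  rw [hcomm]
  set P := ∑ a, ∑ s ∈ Finset.Icc 1 N, linf (g a s - g a (s - 1)) ^ 2 with hP
  have hP0 : 0 ≤ P := Finset.sum_nonneg fun a _ => Finset.sum_nonneg fun s _ => sq_nonneg _
  have hroot : ∑ a, Real.sqrt (d * L * (4 + ∑ s ∈ Finset.Icc 1 N, linf (g a s - g a (s - 1)) ^ 2))
      ≤ 2 * (d * Real.sqrt d * L) + d * Real.sqrt (L * P) := by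
    have h1 := Real.sum_sqrt_mul_sqrt_le (Finset.univ : Finset (Fin d))
      (f := fun _ => (d : ℝ) * L)
      (g := fun a => 4 + ∑ s ∈ Finset.Icc 1 N, linf (g a s - g a (s - 1)) ^ 2)
      (fun a => by positivity) (fun a => by positivity)
    simp only [← Real.sqrt_mul (show 0 ≤ (d : ℝ) * L by positivity)] at h1
    refine h1.trans ?_
    simp only [Finset.sum_add_distrib, Finset.sum_const, Finset.card_univ, Fintype.card_fin,
      nsmul_eq_mul, ← hP]
    have h2 : Real.sqrt (d * (d * L)) = d * Real.sqrt L := by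
      rw [← mul_assoc, Real.sqrt_mul (by positivity), Real.sqrt_mul_self (by positivity)]
    have h3 : Real.sqrt (d * 4 + P) ≤ 2 * Real.sqrt d + Real.sqrt P := by
      rw [Real.sqrt_le_left (by positivity)]
      nlinarith [Real.sq_sqrt hP0, Real.sqrt_nonneg P]
    rw [h2, Real.sqrt_mul (by linarith) P]
    have h4 : Real.sqrt L ≤ L := by nlinarith
    have h5 := mul_le_mul_of_nonneg_left h3 (show 0 ≤ (d : ℝ) * Real.sqrt L by positivity)
    have h6 := mul_le_mul_of_nonneg_left h4 (show 0 ≤ (d : ℝ) * Real.sqrt d by positivity)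
    nlinarith
  have hend : ∑ a, linf (g a (N + 1) - g a N) ≤ 2 := by
    have h1 := (hp (N + 1) (by simp)).2
    have h2 := (hp N (by simp; omega)).2
    have h3 : ∀ a ∈ (Finset.univ : Finset (Fin d)),
        linf (g a (N + 1) - g a N) ≤ p (N + 1) a + p N a := fun a _ =>
      (linf_sub_le _ _).trans (add_le_add (hgle a _ (by simp)) (hgle a _ (by simp; omega)))
    have h4 := Finset.sum_le_sum h3
    rw [Finset.sum_add_distrib, h1, h2] at h4
    linarith
  have hmix : 2 / T * ∑ a, ∑ t ∈ Finset.Icc 1 (N + 1), linf (g a t) ≤ 2 := by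
    rw [Finset.sum_comm]
    have h1 : ∀ t ∈ Finset.Icc 1 (N + 1), ∑ a, linf (g a t) ≤ 1 := fun t ht => by
      rw [← (hp t ht).2]
      exact Finset.sum_le_sum fun a _ => hgle a t ht
    have h2 := Finset.sum_le_sum h1
    simp only [Finset.sum_const, Nat.card_Icc, nsmul_eq_mul, mul_one, Nat.add_sub_cancel] at h2
    calc 2 / T * ∑ t ∈ Finset.Icc 1 (N + 1), ∑ a, linf (g a t) ≤ 2 / T * T :=
          mul_le_mul_of_nonneg_left h2 (by positivity)
      _ = 2 := by
          have : T ≠ 0 := by linarith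
          field_simp
  have hpath : n / (4 * Real.sqrt d) * ∑ s ∈ Finset.Icc 1 N, l1 (p (s + 1) - p s) ^ 2
      ≤ 128 * n * Real.sqrt d
        * ∑ a, ∑ s ∈ Finset.Icc 1 N, barrierDiv (y a (s + 1)) (y a s) := by
    rw [Finset.sum_comm, Finset.mul_sum, Finset.mul_sum]
    refine Finset.sum_le_sum fun s hs => ?_
    have hs' := Finset.mem_Icc.mp hs
    have hm1 : s ∈ Finset.Icc 1 (N + 1) := by simp; omega
    have hm2 : s + 1 ∈ Finset.Icc 1 (N + 1) := by simp; omega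
    have hD : ∀ a, 0 ≤ barrierDiv (y a (s + 1)) (y a s) := fun a =>
      barrierDiv_nonneg (hy a _ hm2).2.1 (hy a _ hm1).2.1
    have h1 := stationary_perturb (Q := fun a => y a s) (R := fun a => y a (s + 1))
      (μ := fun a => Real.sqrt (8 * barrierDiv (y a (s + 1)) (y a s)))
      (fun a => (hy a s hm1).1) (fun a => (hy a (s + 1) hm2).1)
      (fun a => (hy a s hm1).2.1) (fun a => (hy a (s + 1) hm2).2.1)
      (fun a => Real.sqrt_nonneg _)
      (fun a h b => abs_sub_le_of_barrierDiv (hy a _ hm2).2.1 (hy a _ hm1).2.1 h b)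
      (hp s hm1) (hp (s + 1) hm2) (hst s hm1) (hst (s + 1) hm2)
    rw [l1_sub_comm] at h1
    have h2 := sq_sum_le_card_mul_sum_sq (s := (Finset.univ : Finset (Fin d)))
      (f := fun a => Real.sqrt (8 * barrierDiv (y a (s + 1)) (y a s)))
    have h3 : ∑ a, Real.sqrt (8 * barrierDiv (y a (s + 1)) (y a s)) ^ 2
        = 8 * ∑ a, barrierDiv (y a (s + 1)) (y a s) := by
      rw [Finset.mul_sum]
      exact Finset.sum_congr rfl fun a _ => Real.sq_sqrt (by linarith [hD a])
    rw [h3, Finset.card_univ, Fintype.card_fin] at h2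
    have h4 := pow_le_pow_left₀ (l1_nonneg _) h1 2
    rw [mul_pow] at h4
    have h5 : l1 (p (s + 1) - p s) ^ 2
        ≤ 512 * d * ∑ a, barrierDiv (y a (s + 1)) (y a s) := by linarith
    have h6 : n / (4 * Real.sqrt d) * (512 * d * ∑ a, barrierDiv (y a (s + 1)) (y a s))
        = 128 * n * Real.sqrt d * ∑ a, barrierDiv (y a (s + 1)) (y a s) := by
      rw [div_mul_eq_mul_div, div_eq_iff (by positivity)]
      linear_combination
        (-(512 * n * ∑ a, barrierDiv (y a (s + 1)) (y a s))) * hsd2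
    rw [← h6]
    exact mul_le_mul_of_nonneg_left h5 (by positivity)
  have hnL : 1 ≤ n * L := by nlinarith
  have hdd : d * Real.sqrt d ≤ (d : ℝ) ^ 2 * Real.sqrt d :=
    mul_le_mul_of_nonneg_right (by nlinarith) (by positivity)
  have hdd1 : 1 ≤ (d : ℝ) ^ 2 * Real.sqrt d := by nlinarith
  have hlow1 : d * Real.sqrt d * L ≤ d ^ 2 * Real.sqrt d * (n * L) :=
    mul_le_mul hdd (by nlinarith) (by linarith) (by positivity)
  have hlow2 : 1 ≤ d ^ 2 * Real.sqrt d * (n * L) := by nlinarith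
  nlinarith

/-! ### Expected utilities -/

lemma sum_prod_simplex {n : ℕ} {m : Fin n → ℕ} {f : ∀ j, Fin (m j) → ℝ}
    (hf : ∀ j, f j ∈ simplex (m j)) : ∑ a : ∀ j, Fin (m j), ∏ j, f j (a j) = 1 := by
  rw [← Fintype.prod_sum]
  exact Finset.prod_eq_one fun j _ => (hf j).2

/-- Changing one factor of a product distribution. -/
lemma sum_abs_prod_sub_le_of_eq_off {n : ℕ} {m : Fin n → ℕ} {f g : ∀ j, Fin (m j) → ℝ}
    (hf : ∀ j, f j ∈ simplex (m j)) (i : Fin n) (hfg : ∀ j ≠ i, g j = f j) :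
    ∑ a : ∀ j, Fin (m j), |∏ j, f j (a j) - ∏ j, g j (a j)| ≤ l1 (f i - g i) := by
  have h : ∀ a : ∀ j, Fin (m j), |∏ j, f j (a j) - ∏ j, g j (a j)|
      = ∏ j, Function.update f i (fun k => |(f i - g i) k|) j (a j) := by
    intro a
    rw [← Finset.mul_prod_erase _ _ (Finset.mem_univ i),
      ← Finset.mul_prod_erase _ (fun j => g j (a j)) (Finset.mem_univ i),
      ← Finset.mul_prod_erase _ (fun j => Function.update f i _ j (a j)) (Finset.mem_univ i)]
    have h1 : ∏ j ∈ Finset.univ.erase i, g j (a j) = ∏ j ∈ Finset.univ.erase i, f j (a j) :=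
      Finset.prod_congr rfl fun j hj => by rw [hfg j (Finset.ne_of_mem_erase hj)]
    have h2 : ∏ j ∈ Finset.univ.erase i, Function.update f i (fun k => |(f i - g i) k|) j (a j)
        = ∏ j ∈ Finset.univ.erase i, f j (a j) :=
      Finset.prod_congr rfl fun j hj => by
        rw [Function.update_of_ne (Finset.ne_of_mem_erase hj)]
    rw [h1, h2, Function.update_self, ← sub_mul, abs_mul,
      abs_of_nonneg (Finset.prod_nonneg fun j _ => (hf j).1 (a j))]
    rfl
  rw [Finset.sum_congr rfl fun a _ => h a, ← Fintype.prod_sum,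
    ← Finset.mul_prod_erase _ _ (Finset.mem_univ i), Function.update_self]
  rw [Finset.prod_eq_one fun j hj => by
    rw [Function.update_of_ne (Finset.ne_of_mem_erase hj)]
    exact (hf j).2, mul_one]
  rfl

/-- Total variation distance of product distributions. -/
lemma sum_abs_prod_sub_le {n : ℕ} {m : Fin n → ℕ} {f g : ∀ j, Fin (m j) → ℝ}
    (hf : ∀ j, f j ∈ simplex (m j)) (hg : ∀ j, g j ∈ simplex (m j)) :
    ∑ a : ∀ j, Fin (m j), |∏ j, f j (a j) - ∏ j, g j (a j)| ≤ ∑ j, l1 (f j - g j) := by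
  have key : ∀ S : Finset (Fin n), ∑ a : ∀ j, Fin (m j),
      |∏ j, f j (a j) - ∏ j, (if j ∈ S then g j else f j) (a j)| ≤ ∑ j ∈ S, l1 (f j - g j) := by
    intro S
    induction S using Finset.induction_on with
    | empty => simp
    | insert i S hi ih =>
      have hmix : ∀ j, (if j ∈ S then g j else f j) ∈ simplex (m j) := fun j => by
        by_cases h : j ∈ S
        · simpa [h] using hg j
        · simpa [h] using hf j
      have h1 := sum_abs_prod_sub_le_of_eq_off hmix i
        (g := fun j => if j ∈ insert i S then g j else f j)
        (fun j hj => by simp [Finset.mem_insert, hj])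
      simp only [hi, if_false, Finset.mem_insert_self, if_true] at h1
      rw [Finset.sum_insert hi]
      refine le_trans ?_ (add_le_add h1 ih)
      rw [← Finset.sum_add_distrib]
      refine Finset.sum_le_sum fun a _ => ?_
      rw [add_comm]
      exact abs_sub_le _ _ _
  simpa using key Finset.univ

lemma expected_utility_eq {n : ℕ} {m : Fin n → ℕ} (u : (∀ j, Fin (m j)) → ℝ)
    (x : ∀ j, Fin (m j) → ℝ) (i : Fin n) (k : Fin (m i)) :
    (∑ a : ∀ j, Fin (m j), if a i = k then u a * ∏ j ∈ Finset.univ.erase i, x j (a j) else 0)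
      = ∑ a : ∀ j, Fin (m j), u a * ∏ j, Function.update x i (Pi.single k 1) j (a j) := by
  refine Finset.sum_congr rfl fun a _ => ?_
  rw [← Finset.mul_prod_erase _ (fun j => Function.update x i (Pi.single k 1) j (a j))
    (Finset.mem_univ i), Function.update_self]
  have h : ∏ j ∈ Finset.univ.erase i, Function.update x i (Pi.single k 1) j (a j)
      = ∏ j ∈ Finset.univ.erase i, x j (a j) :=
    Finset.prod_congr rfl fun j hj => by
      rw [Function.update_of_ne (Finset.ne_of_mem_erase hj)]
  rw [h, Pi.single_apply]
  split_ifs <;> simp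

lemma update_single_mem_simplex {n : ℕ} {m : Fin n → ℕ} {x : ∀ j, Fin (m j) → ℝ}
    (hx : ∀ j, x j ∈ simplex (m j)) (i : Fin n) (k : Fin (m i)) (j : Fin n) :
    Function.update x i (Pi.single k 1) j ∈ simplex (m j) := by
  by_cases h : j = i
  · subst h
    rw [Function.update_self]
    refine ⟨fun l => ?_, by simp⟩
    rw [Pi.single_apply]
    split_ifs <;> norm_num
  · rw [Function.update_of_ne h]
    exact hx j

lemma abs_expected_utility_le_one {n : ℕ} {m : Fin n → ℕ} {u : (∀ j, Fin (m j)) → ℝ}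
    (hu : ∀ a, u a ∈ Set.Icc (-1 : ℝ) 1) {x : ∀ j, Fin (m j) → ℝ}
    (hx : ∀ j, x j ∈ simplex (m j)) (i : Fin n) (k : Fin (m i)) :
    |∑ a : ∀ j, Fin (m j), if a i = k then u a * ∏ j ∈ Finset.univ.erase i, x j (a j) else 0|
      ≤ 1 := by
  have hs := update_single_mem_simplex hx i k
  rw [expected_utility_eq]
  refine ((Finset.abs_sum_le_sum_abs _ _).trans (Finset.sum_le_sum fun a _ => ?_)).trans
    (sum_prod_simplex hs).le
  have h0 : 0 ≤ ∏ j, Function.update x i (Pi.single k 1) j (a j) :=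
    Finset.prod_nonneg fun j _ => (hs j).1 (a j)
  rw [abs_mul, abs_of_nonneg h0]
  have := abs_le.mpr (hu a)
  nlinarith

/-- Expected utilities are Lipschitz in the strategies of the players. -/
lemma abs_expected_utility_sub_le {n : ℕ} {m : Fin n → ℕ} {u : (∀ j, Fin (m j)) → ℝ}
    (hu : ∀ a, u a ∈ Set.Icc (-1 : ℝ) 1) {x z : ∀ j, Fin (m j) → ℝ}
    (hx : ∀ j, x j ∈ simplex (m j)) (hz : ∀ j, z j ∈ simplex (m j)) (i : Fin n)
    (k : Fin (m i)) :
    |(∑ a : ∀ j, Fin (m j), if a i = k then u a * ∏ j ∈ Finset.univ.erase i, x j (a j) else 0)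
      - ∑ a : ∀ j, Fin (m j), if a i = k then u a * ∏ j ∈ Finset.univ.erase i, z j (a j) else 0|
      ≤ ∑ j, l1 (x j - z j) := by
  rw [expected_utility_eq, expected_utility_eq, ← Finset.sum_sub_distrib]
  have h := sum_abs_prod_sub_le (update_single_mem_simplex hx i k)
    (update_single_mem_simplex hz i k)
  refine (Finset.abs_sum_le_sum_abs _ _).trans (le_trans ?_ (h.trans ?_))
  · refine Finset.sum_le_sum fun a _ => ?_
    rw [← mul_sub, abs_mul]
    exact mul_le_of_le_one_left (abs_nonneg _) (abs_le.mpr (hu a))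
  · refine Finset.sum_le_sum fun j _ => ?_
    by_cases hj : j = i
    · subst hj
      rw [Function.update_self, Function.update_self, sub_self]
      simpa [l1] using l1_nonneg (x j - z j)
    · rw [Function.update_of_ne hj, Function.update_of_ne hj]

/-! ### Combining the players -/

lemma rowStoch_one (d : ℕ) : rowStoch (fun a : Fin d => (Pi.single a 1 : Fin d → ℝ)) := by
  intro a
  refine ⟨fun k => ?_, by simp⟩
  simp only [Pi.single_apply]
  split_ifs <;> norm_num

lemma mvec_one {d : ℕ} (v : Fin d → ℝ) :
    mvec (fun a : Fin d => (Pi.single a 1 : Fin d → ℝ)) v = v := by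
  ext a
  simp [mvec, Pi.single_apply]

/-- Replacing the prescribed strategy and the observed utility by the true ones. -/
lemma inp_swap_le {d : ℕ} {M : Fin d → Fin d → ℝ} (hM : rowStoch M) {x z v w : Fin d → ℝ}
    (hz : z ∈ simplex d) (hv : linf v ≤ 1) :
    inp x (mvec M v - v) ≤ inp z (mvec M w - w) + 2 * l1 (x - z) + 2 * linf (v - w) := by
  have h1 : inp (x - z) (mvec M v - v) ≤ 2 * l1 (x - z) := by
    have h2 := (le_abs_self _).trans (abs_inp_le (x - z) (mvec M v - v))
    have h3 := linf_sub_le (mvec M v) v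
    have h4 := linf_mvec_le hM v
    nlinarith [l1_nonneg (x - z)]
  have h5 : inp z (mvec M (v - w) - (v - w)) ≤ 2 * linf (v - w) := by
    have h2 := (le_abs_self _).trans (abs_inp_le z (mvec M (v - w) - (v - w)))
    have h3 := linf_sub_le (mvec M (v - w)) (v - w)
    have h4 := linf_mvec_le hM (v - w)
    rw [l1_simplex hz] at h2
    linarith
  simp only [mvec_sub, inp_sub_left, inp_sub_right] at h1 h5 ⊢
  linarith

lemma sq_le_of_le_add_sum {n : ℕ} {A b c : ℝ} {e f g : Fin n → ℝ} (hA : 0 ≤ A) (hb : 0 ≤ b)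
    (hc : 0 ≤ c) (hb2 : b ≤ 2) (hc2 : c ≤ 2) (he : ∀ l, 0 ≤ e l) (hf : ∀ l, 0 ≤ f l)
    (he2 : ∀ l, e l ≤ 2) (hf2 : ∀ l, f l ≤ 2) (h : A ≤ b + c + ∑ l, (e l + f l + g l)) :
    A ^ 2 ≤ 6 * b + 6 * c + 9 * n * ∑ l, (2 * e l + 2 * f l + g l ^ 2) := by
  have h1 := sq_sum_le_card_mul_sum_sq (s := (Finset.univ : Finset (Fin n)))
    (f := fun l => e l + f l + g l)
  rw [Finset.card_univ, Fintype.card_fin] at h1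
  have h2 : ∑ l, (e l + f l + g l) ^ 2 ≤ 3 * ∑ l, (2 * e l + 2 * f l + g l ^ 2) := by
    rw [Finset.mul_sum]
    refine Finset.sum_le_sum fun l _ => ?_
    nlinarith [sq_nonneg (e l - f l), sq_nonneg (e l - g l), sq_nonneg (f l - g l),
      mul_nonneg (he l) (sub_nonneg.mpr (he2 l)), mul_nonneg (hf l) (sub_nonneg.mpr (hf2 l))]
  have h3 := mul_le_mul_of_nonneg_left h2 (Nat.cast_nonneg (α := ℝ) n)
  have h4 := pow_le_pow_left₀ hA h 2
  set X := ∑ l, (e l + f l + g l)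
  nlinarith [sq_nonneg (b - c), sq_nonneg (b - X), sq_nonneg (c - X),
    mul_nonneg hb (sub_nonneg.mpr hb2), mul_nonneg hc (sub_nonneg.mpr hc2)]

lemma leading_term_mono {n d m L : ℝ} (hd : 1 ≤ d) (hdm : d ≤ m) (hn : 1 ≤ n) (hL : 1 ≤ L) :
    n * (d ^ 2 * Real.sqrt d) * L ≤ n * (m ^ 2 * Real.sqrt m) * L := by
  have := Real.sqrt_le_sqrt hdm
  gcongr

lemma player_bound_mono {n d m L P Z : ℝ} (hd : 1 ≤ d) (hdm : d ≤ m) (hn : 1 ≤ n) (hL : 1 ≤ L)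
    (hPZ : P ≤ Z) :
    278 * n * (d ^ 2 * Real.sqrt d) * L + 8 * d * Real.sqrt (L * P)
      ≤ 278 * n * (m ^ 2 * Real.sqrt m) * L + 8 * m * Real.sqrt (L * Z) := by
  have h1 := leading_term_mono hd hdm hn hL
  have h2 : Real.sqrt (L * P) ≤ Real.sqrt (L * Z) :=
    Real.sqrt_le_sqrt (mul_le_mul_of_nonneg_left hPZ (by linarith))
  have h3 := mul_le_mul hdm h2 (Real.sqrt_nonneg _) (by linarith)
  linarith

/-- Nonnegativity of the swap regrets bounds the total path length, and hence the adaptive part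
of the regret. -/
lemma self_bounding {n m L D S : ℝ} (hn : 1 ≤ n) (hm : 1 ≤ m) (hL : 1 ≤ L) (hS : 0 ≤ S)
    (hD : 0 ≤ D)
    (h : n / (4 * Real.sqrt m) * D ≤ n * (278 * n * (m ^ 2 * Real.sqrt m) * L
      + 8 * m * Real.sqrt (L * (72 * (1 + S + n * D))))) :
    8 * m * Real.sqrt (L * (72 * (1 + S + n * D)))
      ≤ 96 * m * Real.sqrt (S * L) + 18712 * n * (m ^ 2 * Real.sqrt m) * L := by
  have hr : 1 ≤ Real.sqrt m := Real.one_le_sqrt.mpr hm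
  have hr2 : Real.sqrt m ^ 2 = m := Real.sq_sqrt (by linarith)
  set r := Real.sqrt m
  set Z := 1 + S + n * D with hZ
  have hZ0 : 0 ≤ Z := by positivity
  set q := n * (m * r) with hq
  have hq1 : 1 ≤ q := one_le_mul_of_one_le_of_one_le hn (one_le_mul_of_one_le_of_one_le hm hr)
  have hq2 : n ^ 2 * m ^ 3 = q ^ 2 := by
    rw [hq, mul_pow, mul_pow, hr2]
    ring
  set w := Real.sqrt (L * (72 * Z)) with hw
  have hw2 : w ^ 2 = L * (72 * Z) := Real.sq_sqrt (by positivity)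
  have hnD : n * D ≤ 1112 * (q ^ 2 * L) + 32 * q * w := by
    rw [div_mul_eq_mul_div, div_le_iff₀ (by positivity)] at h
    refine h.trans (le_of_eq ?_)
    rw [← hq2, hq]
    linear_combination (1112 * n ^ 2 * m ^ 2 * L) * hr2
  have hamgm : 32 * q * w ≤ Z / 2 + 36864 * (q ^ 2 * L) := by
    have hα : Real.sqrt (72 * L) ^ 2 = 72 * L := Real.sq_sqrt (by positivity)
    have hζ : Real.sqrt Z ^ 2 = Z := Real.sq_sqrt hZ0
    have hwe : w = Real.sqrt (72 * L) * Real.sqrt Z := by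
      rw [hw, ← Real.sqrt_mul (by positivity)]
      ring_nf
    rw [hwe]
    nlinarith [sq_nonneg (32 * q * Real.sqrt (72 * L) - Real.sqrt Z)]
  have hZle : Z ≤ 2 + 2 * S + 75952 * (q ^ 2 * L) := by
    rw [hZ] at hamgm ⊢
    linarith
  have hwle : w ≤ 12 * Real.sqrt (S * L) + 2339 * (q * L) := by
    have hs2 : Real.sqrt (S * L) ^ 2 = S * L := Real.sq_sqrt (by positivity)
    have hs0 := Real.sqrt_nonneg (S * L)
    have hqL : 1 ≤ q * L := one_le_mul_of_one_le_of_one_le hq1 hL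
    refine le_of_sq_le_sq ?_ (by positivity)
    rw [hw2]
    have h1 := mul_le_mul_of_nonneg_left hZle (show 0 ≤ 72 * L by positivity)
    have h2 : L ≤ (q * L) ^ 2 := by nlinarith
    have h3 : 0 ≤ Real.sqrt (S * L) * (q * L) := by positivity
    nlinarith
  have hfin := mul_le_mul_of_nonneg_left hwle (show 0 ≤ 8 * m by positivity)
  refine hfin.trans (le_of_eq ?_)
  rw [hq]
  ring

lemma rpow_five_halves {m : ℝ} (hm : 0 < m) : m ^ ((5 : ℝ) / 2) = m ^ 2 * Real.sqrt m := by
  rw [show (5 : ℝ) / 2 = 2 + 1 / 2 by norm_num, Real.rpow_add hm, Real.sqrt_eq_rpow,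
    Real.rpow_two]

/-- swap regret (w.r.t. the true expected utilities) of every player in
corrupted multi-player general-sum games (Theorem `indiv_swapreg`, first bound). -/
theorem corrupted_general_sum_swap_regret_true_utilities :
    ∃ c : ℝ, 0 < c ∧
    ∀ (n T : ℕ) (m : Fin n → ℕ), 1 ≤ n → 3 ≤ T → (∀ i, 1 ≤ m i) →
    ∀ (u : ∀ i : Fin n, (∀ j : Fin n, Fin (m j)) → ℝ),
      (∀ i a, u i a ∈ Set.Icc (-1 : ℝ) 1) →
    -- played and prescribed strategies; x̂ᵢ⁽⁰⁾ = (1/mᵢ)·𝟙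
    ∀ (x xhat : ∀ i : Fin n, ℕ → Fin (m i) → ℝ),
      (∀ i, ∀ t ∈ Finset.Icc 1 T, x i t ∈ simplex (m i)) →
      (∀ i, ∀ t ∈ Finset.Icc 1 T, xhat i t ∈ simplex (m i)) →
      (∀ i, xhat i 0 = fun _ => 1 / (m i : ℝ)) →
    -- corruption levels for strategies
    ∀ (Chat Ctil : Fin n → ℝ),
      (∀ i, ∑ t ∈ Finset.Icc 1 T, l1 (x i t - xhat i t) ≤ Chat i) →
    -- expected utilities induced by the actual plays
    ∀ (U : ∀ i : Fin n, ℕ → Fin (m i) → ℝ),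
      (∀ i t ai, U i t ai = ∑ a : ∀ j : Fin n, Fin (m j),
        if a i = ai then u i a * ∏ j ∈ Finset.univ.erase i, x j t (a j) else 0) →
    -- observed (corrupted) utilities
    ∀ (util : ∀ i : Fin n, ℕ → Fin (m i) → ℝ),
      (∀ i, ∀ t ∈ Finset.Icc 1 T, linf (util i t) ≤ 1) →
      (∀ i, ∑ t ∈ Finset.Icc 1 T, linf (U i t - util i t) ≤ Ctil i) →
    -- Algorithm 1: per-expert utilities ũᵢ,ₐ⁽ˢ⁾ = x̂ᵢ⁽ˢ⁾(a)·ũᵢ⁽ˢ⁾ with ũᵢ,ₐ⁽⁰⁾ = 0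
    ∀ (ua : ∀ i : Fin n, Fin (m i) → ℕ → Fin (m i) → ℝ),
      (∀ i a, ua i a 0 = 0) →
      (∀ i a, ∀ s, 1 ≤ s → ua i a s = xhat i s a • util i s) →
    -- adaptive per-expert learning rates
    ∀ (η : ∀ i : Fin n, Fin (m i) → ℕ → ℝ),
      (∀ i a t, η i a t = min
        (Real.sqrt (((m i : ℝ) * Real.log T / 8) /
          (4 + ∑ s ∈ Finset.Icc 1 (t - 1), (linf (ua i a s - ua i a (s - 1))) ^ 2)))
        (1 / (256 * (n : ℝ) * Real.sqrt (m i)))) →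
    -- OFTRL with log-barrier for each expert a
    ∀ (y : ∀ i : Fin n, Fin (m i) → ℕ → Fin (m i) → ℝ),
      (∀ i a, ∀ t ∈ Finset.Icc 1 T,
        y i a t ∈ simplex (m i) ∧ (∀ k, 0 < y i a t k) ∧
        ∀ z ∈ simplex (m i), (∀ k, 0 < z k) →
          inp z (ua i a (t - 1) + ∑ s ∈ Finset.Icc 1 (t - 1), ua i a s)
              - logBarrier z / η i a t
            ≤ inp (y i a t) (ua i a (t - 1) + ∑ s ∈ Finset.Icc 1 (t - 1), ua i a s)
                - logBarrier (y i a t) / η i a t) →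
    -- x̂ᵢ⁽ᵗ⁾ is a stationary distribution of the Markov chain whose a-th row is yᵢ,ₐ⁽ᵗ⁾
    (∀ i, ∀ t ∈ Finset.Icc 1 T, ∀ b, ∑ a, y i a t b * xhat i t a = xhat i t b) →
    -- abbreviations: mmax = max action count, Ŝ and S̃ the total corruption levels
    ∀ (mmax : ℕ), mmax = Finset.univ.sup m →
    ∀ (Shat Stil : ℝ), Shat = ∑ i, Chat i → Stil = ∑ i, Ctil i →
    ∀ i : Fin n, ∀ M : Fin (m i) → Fin (m i) → ℝ, rowStoch M →
      ∑ t ∈ Finset.Icc 1 T, inp (x i t) (mvec M (U i t) - U i t)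
        ≤ c * ((n : ℝ) * (mmax : ℝ) ^ ((5 : ℝ) / 2) * Real.log T
            + min
              ((mmax : ℝ) * Real.sqrt
                ((Shat * ((n : ℝ) + Real.sqrt mmax) + Stil * Real.sqrt mmax)
                  * Real.log T))
              ((m i : ℝ) * Real.sqrt ((T : ℝ) * Real.log T))
            + (2 * Chat i + 2 * Ctil i)) := by
  refine ⟨20000, by norm_num, ?_⟩
  intro n T m hn hT hm u hu x xhat hx hxh _ Chat Ctil hChat U hU util hutil hCtil ua hua0 hua
    η hη y hy hst mmax hmmax Shat Stil hShat hStil i M hM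
  obtain ⟨N, rfl⟩ : ∃ N, T = N + 1 := ⟨T - 1, by omega⟩
  have hN : 2 ≤ N := by omega
  have hn1 : (1 : ℝ) ≤ n := by exact_mod_cast hn
  have hmi : ∀ j, m j ≤ mmax := fun j => hmmax ▸ Finset.le_sup (Finset.mem_univ j)
  have hmiR : ∀ j, (m j : ℝ) ≤ mmax := fun j => by exact_mod_cast hmi j
  have hm1R : ∀ j, (1 : ℝ) ≤ m j := fun j => by exact_mod_cast hm j
  have hmm : (1 : ℝ) ≤ mmax := (hm1R i).trans (hmiR i)
  have hT3 : (3 : ℝ) ≤ (N + 1 : ℕ) := by exact_mod_cast hT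
  have hL1 : 1 ≤ Real.log (N + 1 : ℕ) := by
    rw [Real.le_log_iff_exp_le (by linarith)]
    linarith [Real.exp_one_lt_d9]
  have hm1 : ∀ s ∈ Finset.Icc 1 N, s ∈ Finset.Icc 1 (N + 1) := fun s hs => by
    simp at hs ⊢; omega
  have hm2 : ∀ s ∈ Finset.Icc 1 N, s + 1 ∈ Finset.Icc 1 (N + 1) := fun s hs => by
    simp at hs ⊢; omega
  have hU1 : ∀ j, ∀ t ∈ Finset.Icc 1 (N + 1), linf (U j t) ≤ 1 := fun j t ht =>
    linf_le zero_le_one fun k => by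
      rw [hU]
      exact abs_expected_utility_le_one (hu j) (fun l => hx l t ht) j k
  have hUdiff : ∀ j, ∀ s ∈ Finset.Icc 1 N,
      linf (U j (s + 1) - U j s) ≤ ∑ l, l1 (x l (s + 1) - x l s) := fun j s hs =>
    linf_le (Finset.sum_nonneg fun l _ => l1_nonneg _) fun k => by
      rw [Pi.sub_apply, hU, hU]
      exact abs_expected_utility_sub_le (hu j) (fun l => hx l _ (hm2 s hs))
        (fun l => hx l _ (hm1 s hs)) j k
  have hChat0 : ∀ j, 0 ≤ Chat j := fun j =>
    (Finset.sum_nonneg fun t _ => l1_nonneg _).trans (hChat j)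
  have hCtil0 : ∀ j, 0 ≤ Ctil j := fun j =>
    (Finset.sum_nonneg fun t _ => linf_nonneg _).trans (hCtil j)
  have hShat0 : 0 ≤ Shat := hShat ▸ Finset.sum_nonneg fun j _ => hChat0 j
  have hStil0 : 0 ≤ Stil := hStil ▸ Finset.sum_nonneg fun j _ => hCtil0 j
  have hCtilS : ∀ j, Ctil j ≤ Stil := fun j => by
    rw [hStil]
    exact Finset.single_le_sum (fun j _ => hCtil0 j) (Finset.mem_univ j)
  -- path lengths of the prescribed strategies
  set D : Fin n → ℝ := fun j => ∑ s ∈ Finset.Icc 1 N, l1 (xhat j (s + 1) - xhat j s) ^ 2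
    with hDdef
  have hD0 : ∀ j, 0 ≤ D j := fun j => Finset.sum_nonneg fun s _ => sq_nonneg _
  set P : Fin n → ℝ := fun j => ∑ s ∈ Finset.Icc 1 N,
    ∑ a, linf (ua j a s - ua j a (s - 1)) ^ 2 with hPdef
  have hDS0 : 0 ≤ ∑ j, D j := Finset.sum_nonneg fun j _ => hD0 j
  have hDj : ∀ j, D j ≤ ∑ l, D l := fun j =>
    Finset.single_le_sum (fun j _ => hD0 j) (Finset.mem_univ j)
  -- variation of the utilities fed to the experts
  have hPle : ∀ j, P j ≤ 1 + ∑ s ∈ Finset.Icc 1 N,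
      ∑ a, linf (ua j a (s + 1) - ua j a s) ^ 2 := by
    intro j
    have h1 := sum_Icc_le_succ (f := fun s => ∑ a, linf (ua j a s - ua j a (s - 1)) ^ 2)
      (fun s => Finset.sum_nonneg fun a _ => sq_nonneg _) N
    rw [sum_Icc_succ_eq_add_shift] at h1
    simp only [Nat.add_sub_cancel, Nat.sub_self] at h1
    refine h1.trans (add_le_add_left ?_ _)
    have hmem : 1 ∈ Finset.Icc 1 (N + 1) := by simp
    refine (Finset.sum_le_sum fun a _ => ?_).trans (sum_sq_simplex_le_one (hxh j 1 hmem))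
    rw [hua0, sub_zero, hua j a 1 le_rfl]
    exact pow_le_pow_left₀ (linf_nonneg _)
      (linf_smul_le_of_linf_le_one ((hxh j 1 hmem).1 a) (hutil j 1 hmem)) 2
  have hstep : ∀ j, ∀ s ∈ Finset.Icc 1 N, ∑ a, linf (ua j a (s + 1) - ua j a s) ^ 2
      ≤ 2 * linf (util j (s + 1) - util j s) ^ 2 + 2 * l1 (xhat j (s + 1) - xhat j s) ^ 2 := by
    intro j s hs
    have h1 := (Finset.mem_Icc.mp hs).1
    have h := sum_linf_weighted_sub_sq_le (q := xhat j s) (v := util j (s + 1))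
      (hxh j _ (hm2 s hs)) (hutil j s (hm1 s hs))
    simpa only [hua j _ (s + 1) (by omega), hua j _ s h1] using h
  have hPT : ∀ j, P j ≤ 16 * (N + 1 : ℕ) := by
    intro j
    refine (hPle j).trans ?_
    have h : ∀ s ∈ Finset.Icc 1 N, ∑ a, linf (ua j a (s + 1) - ua j a s) ^ 2 ≤ 16 := by
      intro s hs
      refine (hstep j s hs).trans ?_
      have h1 := linf_sub_le (util j (s + 1)) (util j s)
      have h2 := hutil j _ (hm1 s hs)
      have h3 := hutil j _ (hm2 s hs)
      have h4 := l1_sub_le_two (hxh j _ (hm2 s hs)) (hxh j _ (hm1 s hs))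
      have h5 := linf_nonneg (util j (s + 1) - util j s)
      have h6 := l1_nonneg (xhat j (s + 1) - xhat j s)
      nlinarith
    have h2 := Finset.sum_le_sum h
    simp only [Finset.sum_const, Nat.card_Icc, nsmul_eq_mul, Nat.add_sub_cancel] at h2
    push_cast
    linarith
  have hutilvar : ∀ j, ∀ s ∈ Finset.Icc 1 N, linf (util j (s + 1) - util j s) ^ 2
      ≤ 6 * linf (U j (s + 1) - util j (s + 1)) + 6 * linf (U j s - util j s)
        + 9 * n * ∑ l, (2 * l1 (x l (s + 1) - xhat l (s + 1)) + 2 * l1 (x l s - xhat l s)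
            + l1 (xhat l (s + 1) - xhat l s) ^ 2) := by
    intro j s hs
    refine sq_le_of_le_add_sum (linf_nonneg _) (linf_nonneg _) (linf_nonneg _) ?_ ?_
      (fun l => l1_nonneg _) (fun l => l1_nonneg _)
      (fun l => l1_sub_le_two (hx l _ (hm2 s hs)) (hxh l _ (hm2 s hs)))
      (fun l => l1_sub_le_two (hx l _ (hm1 s hs)) (hxh l _ (hm1 s hs))) ?_
    · linarith [linf_sub_le (U j (s + 1)) (util j (s + 1)), hU1 j _ (hm2 s hs),
        hutil j _ (hm2 s hs)]
    · linarith [linf_sub_le (U j s) (util j s), hU1 j _ (hm1 s hs), hutil j _ (hm1 s hs)]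
    · have h1 : util j (s + 1) - util j s
          = -(U j (s + 1) - util j (s + 1)) + ((U j s - util j s) + (U j (s + 1) - U j s)) := by
        abel
      have h2 := linf_add_le (-(U j (s + 1) - util j (s + 1)))
        ((U j s - util j s) + (U j (s + 1) - U j s))
      rw [← h1, linf_neg] at h2
      have h3 := linf_add_le (U j s - util j s) (U j (s + 1) - U j s)
      have h4 : ∑ l, l1 (x l (s + 1) - x l s) ≤ ∑ l, (l1 (x l (s + 1) - xhat l (s + 1))
          + l1 (x l s - xhat l s) + l1 (xhat l (s + 1) - xhat l s)) := by
        refine Finset.sum_le_sum fun l _ => ?_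
        have h5 := l1_sub_le (x l (s + 1)) (xhat l (s + 1)) (x l s)
        have h6 := l1_sub_le (xhat l (s + 1)) (xhat l s) (x l s)
        rw [l1_sub_comm (xhat l s)] at h6
        linarith
      linarith [hUdiff j s hs]
  set S := Stil + n * Shat with hSdef
  have hS0 : 0 ≤ S := by positivity
  have hPZ : ∀ j, P j ≤ 72 * (1 + S + n * ∑ l, D l) := by
    intro j
    have h1 := Finset.sum_le_sum (hstep j)
    have h2 := Finset.sum_le_sum (hutilvar j)
    rw [Finset.sum_add_distrib, ← Finset.mul_sum, ← Finset.mul_sum] at h1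
    rw [Finset.sum_add_distrib, Finset.sum_add_distrib, ← Finset.mul_sum, ← Finset.mul_sum,
      ← Finset.mul_sum, Finset.sum_comm] at h2
    have h3 := (sum_Icc_shift_le_succ (f := fun s => linf (U j s - util j s))
      (fun s => linf_nonneg _) N).trans (hCtil j)
    have h4 := (sum_Icc_le_succ (f := fun s => linf (U j s - util j s))
      (fun s => linf_nonneg _) N).trans (hCtil j)
    have h5 : ∑ l, ∑ s ∈ Finset.Icc 1 N, (2 * l1 (x l (s + 1) - xhat l (s + 1))
        + 2 * l1 (x l s - xhat l s) + l1 (xhat l (s + 1) - xhat l s) ^ 2)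
        ≤ 4 * Shat + ∑ l, D l := by
      rw [hShat, Finset.mul_sum, ← Finset.sum_add_distrib]
      refine Finset.sum_le_sum fun l _ => ?_
      rw [Finset.sum_add_distrib, Finset.sum_add_distrib, ← Finset.mul_sum, ← Finset.mul_sum]
      have h6 := (sum_Icc_shift_le_succ (f := fun s => l1 (x l s - xhat l s))
        (fun s => l1_nonneg _) N).trans (hChat l)
      have h7 := (sum_Icc_le_succ (f := fun s => l1 (x l s - xhat l s))
        (fun s => l1_nonneg _) N).trans (hChat l)
      simp only [hDdef]
      linarith
    have h8 := mul_le_mul_of_nonneg_left h5 (show (0 : ℝ) ≤ 9 * n by positivity)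
    have h9 : ∑ l, D l ≤ n * ∑ l, D l := le_mul_of_one_le_left hDS0 hn1
    have h10 := hPle j
    have h11 := hDj j
    have h12 := hCtilS j
    simp only [hDdef] at h8 h9 h11 ⊢
    rw [hSdef]
    nlinarith
  -- swap regret against the observed utilities
  have hreg := fun j {M : Fin (m j) → Fin (m j) → ℝ} (hM : rowStoch M) =>
    player_swap_regret (hm j) hn hN (hxh j) (hutil j) (hua0 j) (fun a s hs => hua j a s hs)
      (hη j) (hy j) (hst j) hM
  have hnonneg : ∀ j, n / (4 * Real.sqrt mmax) * D j
      ≤ 278 * n * (mmax ^ 2 * Real.sqrt mmax) * Real.log (N + 1 : ℕ)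
        + 8 * mmax * Real.sqrt (Real.log (N + 1 : ℕ) * (72 * (1 + S + n * ∑ l, D l))) := by
    intro j
    have h1 := hreg j (rowStoch_one (m j))
    simp only [mvec_one, sub_self] at h1
    simp only [inp, Pi.zero_apply, mul_zero, Finset.sum_const_zero] at h1
    have hsq : Real.sqrt (m j) ≤ Real.sqrt mmax := Real.sqrt_le_sqrt (hmiR j)
    have hsj : 1 ≤ Real.sqrt (m j) := Real.one_le_sqrt.mpr (hm1R j)
    have h2 : n / (4 * Real.sqrt mmax) * D j ≤ n / (4 * Real.sqrt (m j)) * D j :=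
      mul_le_mul_of_nonneg_right
        (div_le_div_of_nonneg_left (by linarith) (by linarith) (by linarith)) (hD0 j)
    have h3 := player_bound_mono (hm1R j) (hmiR j) hn1 hL1 (hPZ j)
    linarith
  have hsum := Finset.sum_le_sum fun j (_ : j ∈ Finset.univ) => hnonneg j
  rw [← Finset.mul_sum] at hsum
  simp only [Finset.sum_const, Finset.card_univ, Fintype.card_fin, nsmul_eq_mul] at hsum
  have hself := self_bounding hn1 hmm hL1 hS0 hDS0 hsum
  have hobs := hreg i hM
  have hneg : 0 ≤ n / (4 * Real.sqrt (m i)) * D i := mul_nonneg (by positivity) (hD0 i)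
  -- passing to the true utilities and the actual plays
  have htrue : ∑ t ∈ Finset.Icc 1 (N + 1), inp (x i t) (mvec M (U i t) - U i t)
      ≤ ∑ t ∈ Finset.Icc 1 (N + 1), inp (xhat i t) (mvec M (util i t) - util i t)
        + (2 * Chat i + 2 * Ctil i) := by
    have h := Finset.sum_le_sum fun t ht =>
      inp_swap_le hM (hxh i t ht) (x := x i t) (w := util i t) (hU1 i t ht)
    rw [Finset.sum_add_distrib, Finset.sum_add_distrib, ← Finset.mul_sum, ← Finset.mul_sum] at h
    linarith [hChat i, hCtil i]
  rw [rpow_five_halves (by linarith)]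
  set L := Real.log (N + 1 : ℕ)
  set A := (n : ℝ) * (mmax ^ 2 * Real.sqrt mmax) * L with hA
  have hA0 : 0 ≤ A := by positivity
  have hC0 : 0 ≤ 2 * Chat i + 2 * Ctil i := by linarith [hChat0 i, hCtil0 i]
  have hbound1 : ∑ t ∈ Finset.Icc 1 (N + 1), inp (x i t) (mvec M (U i t) - U i t)
      ≤ 20000 * (A + mmax * Real.sqrt ((Shat * ((n : ℝ) + Real.sqrt mmax)
          + Stil * Real.sqrt mmax) * L) + (2 * Chat i + 2 * Ctil i)) := by
    have h3 := player_bound_mono (hm1R i) (hmiR i) hn1 hL1 (hPZ i)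
    have h4 : Real.sqrt (S * L) ≤ Real.sqrt ((Shat * ((n : ℝ) + Real.sqrt mmax)
        + Stil * Real.sqrt mmax) * L) := by
      refine Real.sqrt_le_sqrt (mul_le_mul_of_nonneg_right ?_ (by linarith))
      have := Real.one_le_sqrt.mpr hmm
      rw [hSdef]
      nlinarith [mul_nonneg hShat0 (Real.sqrt_nonneg mmax)]
    have h5 := mul_le_mul_of_nonneg_left h4 (show (0 : ℝ) ≤ mmax by positivity)
    have h6 : 0 ≤ mmax * Real.sqrt (S * L) := by positivity
    linarith
  have hbound2 : ∑ t ∈ Finset.Icc 1 (N + 1), inp (x i t) (mvec M (U i t) - U i t)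
      ≤ 20000 * (A + m i * Real.sqrt ((N + 1 : ℕ) * L) + (2 * Chat i + 2 * Ctil i)) := by
    have h3 := player_bound_mono (hm1R i) (hmiR i) hn1 hL1 (le_refl (P i))
    have h4 : Real.sqrt (L * P i) ≤ 4 * Real.sqrt ((N + 1 : ℕ) * L) := by
      rw [Real.sqrt_le_left (by positivity), mul_pow, Real.sq_sqrt (by positivity)]
      nlinarith [mul_le_mul_of_nonneg_left (hPT i) (show 0 ≤ L by linarith)]
    have h5 := mul_le_mul_of_nonneg_left h4 (show (0 : ℝ) ≤ m i by positivity)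
    have h6 : 0 ≤ m i * Real.sqrt ((N + 1 : ℕ) * L) := by positivity
    have h7 := leading_term_mono (hm1R i) (hmiR i) hn1 hL1
    linarith
  rcases min_choice (mmax * Real.sqrt ((Shat * ((n : ℝ) + Real.sqrt mmax)
      + Stil * Real.sqrt mmax) * L)) (m i * Real.sqrt ((N + 1 : ℕ) * L)) with h | h
  · rw [h]
    exact hbound1
  · rw [h]
    exact hbound2
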